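/- arXiv:nlin/0110030 — 3 statements merged into one kernel-verified Lean document; each statement's English description precedes it below -/
import Mathlib

section
/- For every real γ with 0 < γ < 2, the discrete conformal map Z^γ is embedded, i.e. the open interiors of distinct elementary quadrilaterals (Z^γ(n,m), Z^γ(n+1,m), Z^γ(n+1,m+1), Z^γ(n,m+1)) are pairwise disjoint. -/
open Complex Real

noncomputable section

/-- The cross-ratio equation (q): all elementary quadrilaterals are conformal squares. -/
def CrossRatioEq (f : ℕ → ℕ → ℂ) : Prop :=
  ∀ n m : ℕ,
    ((f n m - f (n + 1) m) * (f (n + 1) (m + 1) - f n (m + 1))) /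
      ((f (n + 1) m - f (n + 1) (m + 1)) * (f n (m + 1) - f n m)) = -1

/-- The nonautonomous constraint (c) with parameter `γ`.  When `n = 0` (resp. `m = 0`)
the first (resp. second) summand vanishes, since its coefficient `2*n` (resp. `2*m`) is `0`. -/
def ConstraintC (γ : ℝ) (f : ℕ → ℕ → ℂ) : Prop :=
  ∀ n m : ℕ,
    (γ : ℂ) * f n m =
      2 * (n : ℂ) * ((f (n + 1) m - f n m) * (f n m - f (n - 1) m)) /
          (f (n + 1) m - f (n - 1) m) +
      2 * (m : ℂ) * ((f n (m + 1) - f n m) * (f n m - f n (m - 1))) /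
          (f n (m + 1) - f n (m - 1))

/-- Initial data `f 0 0 = 0`, `f 1 0 = 1`, `f 0 1 = exp (i α)`. -/
def InitialData (f : ℕ → ℕ → ℂ) (α : ℝ) : Prop :=
  f 0 0 = 0 ∧ f 1 0 = 1 ∧ f 0 1 = Complex.exp ((α : ℂ) * Complex.I)

/-- The open interior of the elementary quadrilateral
`(f n m, f (n+1) m, f (n+1) (m+1), f n (m+1))`. -/
def quadInterior (f : ℕ → ℕ → ℂ) (n m : ℕ) : Set ℂ :=
  interior (convexHull ℝ {f n m, f (n + 1) m, f (n + 1) (m + 1), f n (m + 1)})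

/-- A discrete conformal map is embedded if interiors of distinct elementary
quadrilaterals are pairwise disjoint. -/
def Embedded (f : ℕ → ℕ → ℂ) : Prop :=
  ∀ n m n' m' : ℕ, (n, m) ≠ (n', m') →
    Disjoint (quadInterior f n m) (quadInterior f n' m')

/-- Two elementary quadrilaterals are adjacent if their base points are lattice neighbours. -/
def AdjacentQuads (n m n' m' : ℕ) : Prop :=
  (n = n' ∧ (m + 1 = m' ∨ m' + 1 = m)) ∨ (m = m' ∧ (n + 1 = n' ∨ n' + 1 = n))

/-- A discrete conformal map is an immersion if interiors of adjacent elementary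
quadrilaterals are disjoint. -/
def Immersed (f : ℕ → ℕ → ℂ) : Prop :=
  ∀ n m n' m' : ℕ, AdjacentQuads n m n' m' →
    Disjoint (quadInterior f n m) (quadInterior f n' m')

def oneEq (γ n0 m0 W N E S : ℝ) : Prop :=
  n0 * (N + S) * (E - W) + m0 * (N - S) * (E + W) - (γ - 1) * (N + S) * (E + W) = 0

theorem cross_I1 {γ n m R a c d ad cd : ℝ} (h0 : 0 < γ) (h2 : γ < 2) (hm : 1 ≤ m) (hnm : m ≤ n)
    (ha : 0 < a) (hd : 0 < d)
    (hb : n * (R^2 - c*d) * (a+d) = - (m * (R^2 - a*d) * (c+d)))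
    (e1 : oneEq γ (n+1) m R a ad d) (e2 : oneEq γ n (m-1) c R d cd) :
    (n+1) * (d^2 - ad*R) * (R+cd) = -((m-1) * (d^2 - R*cd) * (ad+R)) := by
  unfold oneEq at e1 e2
  have hP : 0 < (n+1)*(a+d) + m*(a-d) - (γ-1)*(a+d) := by
    have : (n+1)*(a+d) + m*(a-d) - (γ-1)*(a+d) = a*(n+m+2-γ) + d*(n-m+2-γ) := by ring
    rw [this]
    have h3 : 0 < n + m + 2 - γ := by linarith
    have h4 : 0 < n - m + 2 - γ := by linarith
    positivity
  have hn : 0 < n := by linarith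
  have key : n * ((n+1)*(a+d) + m*(a-d) - (γ-1)*(a+d)) *
      ((n+1) * (d^2 - ad*R) * (R+cd) + ((m-1) * (d^2 - R*cd) * (ad+R))) = 0 := by
    linear_combination (n+1) * ((-n*(R+cd)+(m-1)*(R-cd)-(γ-1)*(R+cd)) * hb
      - (-n*d*(a+d)+m*(R^2-a*d)) * e2) + n * (-(n+1)*R*(R+cd)+(m-1)*(d^2-R*cd)) * e1
  have := (mul_eq_zero.mp key).resolve_left (by positivity)
  linarith

theorem cross_I2 {γ n m z a b d b' a' : ℝ} (h0 : 0 < γ) (h2 : γ < 2) (hm : 0 ≤ m) (hnm : m ≤ n)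
    (hn : 0 < n) (ha : 0 < a) (hd : 0 < d)
    (hc : n * (z^2 - a*b) * (a+d) = m * (z^2 - a*d) * (a+b))
    (e1 : oneEq γ (n+1) m z a a' d) (e2 : oneEq γ n (m+1) b b' a z) :
    (n+1) * (a^2 - z*a') * (b'+z) = (m+1) * (a^2 - b'*z) * (z+a') := by
  unfold oneEq at e1 e2
  have hP : 0 < (n+1)*(a+d) + m*(a-d) - (γ-1)*(a+d) := by
    have : (n+1)*(a+d) + m*(a-d) - (γ-1)*(a+d) = a*(n+m+2-γ) + d*(n-m+2-γ) := by ring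
    rw [this]
    have h3 : 0 < n + m + 2 - γ := by linarith
    have h4 : 0 < n - m + 2 - γ := by linarith
    positivity
  have key : n * ((n+1)*(a+d) + m*(a-d) - (γ-1)*(a+d)) *
      ((n+1) * (a^2 - z*a') * (b'+z) - (m+1) * (a^2 - b'*z) * (z+a')) = 0 := by
    linear_combination (n+1) * ((-n*(b'+z)+(m+1)*(b'-z)-(γ-1)*(b'+z)) * hc
      - (-n*a*(a+d)-m*(z^2-a*d)) * e2) + n * (-(n+1)*z*(b'+z)-(m+1)*(a^2-b'*z)) * e1
  have := (mul_eq_zero.mp key).resolve_left (by positivity)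
  linarith

theorem X_S {n m R a b c d : ℝ} (hn : 0 < n) (hb : 0 < b) (hcp : 0 < c)
    (hd : n * (R^2 - a*b) * (b+c) = -(m * (R^2-b*c) * (a+b)))
    (ha : n * (R^2 - c*d) * (b+c) = m * (R^2-b*c) * (c+d)) :
    R^2*(a+b+c+d) = a*b*c + a*b*d + a*c*d + b*c*d := by
  have key : n * (b+c) * (R^2*(a+b+c+d) - (a*b*c + a*b*d + a*c*d + b*c*d)) = 0 := by
    linear_combination (c+d) * hd + (a+b) * ha
  have := (mul_eq_zero.mp key).resolve_left (by positivity)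
  linarith

theorem X_b {n m R a b c d : ℝ} (hb : 0 < b) (hcp : 0 < c)
    (hS : R^2*(a+b+c+d) = a*b*c + a*b*d + a*c*d + b*c*d)
    (ha : n * (R^2 - c*d) * (b+c) = m * (R^2-b*c) * (c+d)) :
    n * (R^2 - c*d) * (a+d) = - (m * (R^2 - a*d) * (c+d)) := by
  have key : (b+c) * (n * (R^2 - c*d) * (a+d) + (m * (R^2 - a*d) * (c+d))) = 0 := by
    linear_combination (a+d) * ha + m * (c+d) * hS
  have := (mul_eq_zero.mp key).resolve_left (by positivity)
  linarith

theorem X_c {n m R a b c d : ℝ} (hb : 0 < b) (hcp : 0 < c)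
    (hS : R^2*(a+b+c+d) = a*b*c + a*b*d + a*c*d + b*c*d)
    (hd : n * (R^2 - a*b) * (b+c) = -(m * (R^2-b*c) * (a+b))) :
    n * (R^2 - a*b) * (a+d) = m * (R^2 - a*d) * (a+b) := by
  have key : (b+c) * (n * (R^2 - a*b) * (a+d) - (m * (R^2 - a*d) * (a+b))) = 0 := by
    linear_combination (a+d) * hd - m * (a+b) * hS
  have := (mul_eq_zero.mp key).resolve_left (by positivity)
  linarith

def QQ (γ : ℝ) (D : ℕ → ℝ) : ℕ → ℕ → ℝ
  | 0, m => D m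
  | k+1, 0 => QQ γ D k 0 * (2*k+γ) / (2*k+2-γ)
  | k+1, m+1 => QQ γ D k (m+1) * (QQ γ D k (m+2) * (2*k+γ) + QQ γ D (k+1) m * (2*m+2*k+2+γ)) /
      (QQ γ D k (m+2) * (2*m+2*k+4-γ) + QQ γ D (k+1) m * (2*k+2-γ))
  termination_by k m => (k, m)

theorem QQ_pos {γ : ℝ} (h0 : 0 < γ) (h2 : γ < 2) {D : ℕ → ℝ} (hD : ∀ m, 0 < D m) :
    ∀ k m, 0 < QQ γ D k m := by
  intro k
  induction k with
  | zero => intro m; rw [QQ]; exact hD m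
  | succ k ih =>
    have hk : (0:ℝ) ≤ k := Nat.cast_nonneg k
    have h3 : (0:ℝ) < 2*k+2-γ := by linarith
    intro m
    induction m with
    | zero => rw [QQ]; have := ih 0; positivity
    | succ m ihm =>
      rw [QQ]
      have hm : (0:ℝ) ≤ m := Nat.cast_nonneg m
      have h4 : (0:ℝ) < 2*m+2*k+4-γ := by linarith
      have := ih (m+1); have := ih (m+2)
      positivity

theorem QQ_E0 {γ : ℝ} (h0 : 0 < γ) (h2 : γ < 2) {D : ℕ → ℝ} (k : ℕ) (x : ℝ) :
    oneEq γ (2*k+1) 0 (QQ γ D k 0) x (QQ γ D (k+1) 0) x := by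
  have hk : (0:ℝ) ≤ k := Nat.cast_nonneg k
  have h3 : (2*k+2-γ:ℝ) ≠ 0 := by
    have : (0:ℝ) < 2*k+2-γ := by linarith
    exact this.ne'
  have hE : QQ γ D (k+1) 0 * (2*k+2-γ) = QQ γ D k 0 * (2*k+γ) := by
    rw [QQ.eq_2]; exact div_mul_cancel₀ _ h3
  unfold oneEq
  linear_combination 2*x*hE

theorem QQ_E1 {γ : ℝ} (h0 : 0 < γ) (h2 : γ < 2) {D : ℕ → ℝ} (hD : ∀ m, 0 < D m) (k m : ℕ) :
    oneEq γ (m+2*k+2) (m+1) (QQ γ D k (m+1)) (QQ γ D k (m+2)) (QQ γ D (k+1) (m+1))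
      (QQ γ D (k+1) m) := by
  have hk : (0:ℝ) ≤ k := Nat.cast_nonneg k
  have hm : (0:ℝ) ≤ m := Nat.cast_nonneg m
  have h3 : (0:ℝ) < 2*k+2-γ := by linarith
  have h4 : (0:ℝ) < 2*m+2*k+4-γ := by linarith
  have p1 := QQ_pos h0 h2 hD k (m+2)
  have p2 := QQ_pos h0 h2 hD (k+1) m
  have hE : QQ γ D (k+1) (m+1) *
      (QQ γ D k (m+2) * (2*m+2*k+4-γ) + QQ γ D (k+1) m * (2*k+2-γ)) =
      QQ γ D k (m+1) * (QQ γ D k (m+2) * (2*k+γ) + QQ γ D (k+1) m * (2*m+2*k+2+γ)) := by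
    rw [QQ.eq_3]; exact div_mul_cancel₀ _ (by positivity)
  unfold oneEq
  linear_combination hE

/-- all the lattice relations -/
structure Pat (γ : ℝ) (Q : ℕ → ℕ → ℝ) : Prop where
  pos : ∀ k m, 0 < Q k m
  rho : ∀ k : ℕ, Q (k+1) 0 = Q k 0 * (2*k+γ) / (2*k+2-γ)
  bd : ∀ k, Q (k+1) 0 ^ 2 = Q (k+1) 1 * Q k 1
  diag : ∀ m, Q 0 (m+1) ^ 2 * (Q 0 (m+2) + Q 1 m + Q 0 m + Q 1 m) =
    Q 0 (m+2) * Q 1 m * Q 0 m + Q 0 (m+2) * Q 1 m * Q 1 m + Q 0 (m+2) * Q 0 m * Q 1 m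
      + Q 1 m * Q 0 m * Q 1 m
  S : ∀ k m, Q (k+1) (m+1) ^ 2 * (Q (k+1) (m+2) + Q k (m+2) + Q (k+1) m + Q (k+2) m) =
    Q (k+1) (m+2) * Q k (m+2) * Q (k+1) m + Q (k+1) (m+2) * Q k (m+2) * Q (k+2) m
      + Q (k+1) (m+2) * Q (k+1) m * Q (k+2) m + Q k (m+2) * Q (k+1) m * Q (k+2) m
  Xa : ∀ k m : ℕ, ((m:ℝ)+2*k+3) * (Q (k+1) (m+1) ^ 2 - Q (k+1) m * Q (k+2) m) *
      (Q k (m+2) + Q (k+1) m) =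
    (m+1) * (Q (k+1) (m+1) ^ 2 - Q k (m+2) * Q (k+1) m) * (Q (k+1) m + Q (k+2) m)
  Xc : ∀ k m : ℕ, ((m:ℝ)+2*k+3) * (Q (k+1) (m+1) ^ 2 - Q (k+1) (m+2) * Q k (m+2)) *
      (Q (k+1) (m+2) + Q (k+2) m) =
    (m+1) * (Q (k+1) (m+1) ^ 2 - Q (k+1) (m+2) * Q (k+2) m) * (Q (k+1) (m+2) + Q k (m+2))

theorem QQ_pat {γ : ℝ} (h0 : 0 < γ) (h2 : γ < 2) {D : ℕ → ℝ} (hD : ∀ m, 0 < D m)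
    (hdiag : ∀ m, D (m+1) ^ 2 * (D (m+2) + QQ γ D 1 m + D m + QQ γ D 1 m) =
    D (m+2) * QQ γ D 1 m * D m + D (m+2) * QQ γ D 1 m * QQ γ D 1 m + D (m+2) * D m * QQ γ D 1 m
      + QQ γ D 1 m * D m * QQ γ D 1 m) : Pat γ (QQ γ D) := by
  have pos := QQ_pos h0 h2 hD
  have E0 := fun k x => QQ_E0 (D := D) h0 h2 k x
  have E1 := QQ_E1 h0 h2 hD
  have Q0 : ∀ m, QQ γ D 0 m = D m := fun m => by rw [QQ]
  have rho : ∀ k : ℕ, QQ γ D (k+1) 0 = QQ γ D k 0 * (2*k+γ) / (2*k+2-γ) := fun k => by rw [QQ]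
  simp only [← Q0] at hdiag
  clear Q0
  generalize QQ γ D = Q at *
  have main : ∀ k : ℕ,
      (∀ m : ℕ, ((m:ℝ)+1+2*k) * (Q k (m+1) ^ 2 - Q k m * Q (k+1) m) * (Q k (m+2) + Q (k+1) m) =
        -((m+1) * (Q k (m+1) ^ 2 - Q k (m+2) * Q (k+1) m) * (Q k m + Q (k+1) m))) →
      Q (k+1) 0 ^ 2 = Q (k+1) 1 * Q k 1 ∧
      ∀ m : ℕ, (Q (k+1) (m+1) ^ 2 * (Q (k+1) (m+2) + Q k (m+2) + Q (k+1) m + Q (k+2) m) =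
      Q (k+1) (m+2) * Q k (m+2) * Q (k+1) m + Q (k+1) (m+2) * Q k (m+2) * Q (k+2) m
      + Q (k+1) (m+2) * Q (k+1) m * Q (k+2) m + Q k (m+2) * Q (k+1) m * Q (k+2) m) ∧
      (((m:ℝ)+2*k+3) * (Q (k+1) (m+1) ^ 2 - Q (k+1) m * Q (k+2) m) * (Q k (m+2) + Q (k+1) m) =
      (m+1) * (Q (k+1) (m+1) ^ 2 - Q k (m+2) * Q (k+1) m) * (Q (k+1) m + Q (k+2) m)) ∧
      (((m:ℝ)+2*k+3) * (Q (k+1) (m+1) ^ 2 - Q (k+1) (m+2) * Q k (m+2)) *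
      (Q (k+1) (m+2) + Q (k+2) m) =
      (m+1) * (Q (k+1) (m+1) ^ 2 - Q (k+1) (m+2) * Q (k+2) m) * (Q (k+1) (m+2) + Q k (m+2))) := by
    intro k hk
    have hk0 : (0:ℝ) ≤ k := Nat.cast_nonneg k
    have bd : Q (k+1) 0 ^ 2 = Q (k+1) 1 * Q k 1 := by
      have e1 := E1 k 0
      have e2 := E0 k (Q k 1)
      have hb := hk 0
      norm_num at e1 e2 hb
      have := cross_I1 (γ := γ) (n := 2*k+1) (m := 1) (R := Q k 1) (a := Q k 2) (c := Q k 0)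
        (d := Q (k+1) 0) (ad := Q (k+1) 1) (cd := Q k 1) h0 h2 le_rfl (by linarith)
        (pos _ _) (pos _ _) (by linear_combination hb) (by convert e1 using 1; ring)
        (by convert e2 using 1; ring)
      have p := pos k 1
      have h : (2*(k:ℝ)+2) * (Q k 1 + Q k 1) * (Q (k+1) 0 ^ 2 - Q (k+1) 1 * Q k 1) = 0 := by
        linear_combination this
      have := (mul_eq_zero.mp h).resolve_left (by positivity)
      linarith
    have Xd : ∀ m : ℕ, ((m:ℝ)+2*k+3) * (Q (k+1) (m+1) ^ 2 - Q (k+1) (m+2) * Q k (m+2)) *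
        (Q k (m+2) + Q (k+1) m) =
        -((m+1) * (Q (k+1) (m+1) ^ 2 - Q k (m+2) * Q (k+1) m) * (Q (k+1) (m+2) + Q k (m+2))) := by
      intro m
      have hm0 : (0:ℝ) ≤ m := Nat.cast_nonneg m
      have e1 := E1 k (m+1)
      have e2 := E1 k m
      have hb := hk (m+1)
      push_cast at e1 hb
      have := cross_I1 (γ := γ) (n := m+2+2*k) (m := m+2) (R := Q k (m+2)) (a := Q k (m+3))
        (c := Q k (m+1))
        (d := Q (k+1) (m+1)) (ad := Q (k+1) (m+2)) (cd := Q (k+1) m) h0 h2 (by linarith)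
        (by linarith)
        (pos _ _) (pos _ _) (by linear_combination hb) (by convert e1 using 1 <;> ring)
        (by convert e2 using 1 <;> ring)
      linear_combination this
    refine ⟨bd, ?_⟩
    have full : ∀ m : ℕ, (((m:ℝ)+2*k+3) * (Q (k+1) (m+1) ^ 2 - Q (k+1) m * Q (k+2) m) *
        (Q k (m+2) + Q (k+1) m) =
        (m+1) * (Q (k+1) (m+1) ^ 2 - Q k (m+2) * Q (k+1) m) * (Q (k+1) m + Q (k+2) m)) →
        (Q (k+1) (m+1) ^ 2 * (Q (k+1) (m+2) + Q k (m+2) + Q (k+1) m + Q (k+2) m) =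
      Q (k+1) (m+2) * Q k (m+2) * Q (k+1) m + Q (k+1) (m+2) * Q k (m+2) * Q (k+2) m
      + Q (k+1) (m+2) * Q (k+1) m * Q (k+2) m + Q k (m+2) * Q (k+1) m * Q (k+2) m) ∧
      (((m:ℝ)+2*k+3) * (Q (k+1) (m+1) ^ 2 - Q (k+1) m * Q (k+2) m) * (Q k (m+2) + Q (k+1) m) =
      (m+1) * (Q (k+1) (m+1) ^ 2 - Q k (m+2) * Q (k+1) m) * (Q (k+1) m + Q (k+2) m)) ∧
      (((m:ℝ)+2*k+3) * (Q (k+1) (m+1) ^ 2 - Q (k+1) (m+2) * Q k (m+2)) *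
      (Q (k+1) (m+2) + Q (k+2) m) =
      (m+1) * (Q (k+1) (m+1) ^ 2 - Q (k+1) (m+2) * Q (k+2) m) *
        (Q (k+1) (m+2) + Q k (m+2))) := by
      intro m ha
      have hm0 : (0:ℝ) ≤ m := Nat.cast_nonneg m
      have hS := X_S (by positivity) (pos _ _) (pos _ _) (Xd m) ha
      exact ⟨hS, ha, X_c (pos _ _) (pos _ _) hS (Xd m)⟩
    intro m
    induction m with
    | zero =>
      apply full
      have e1 := E0 (k+1) (Q (k+1) 1)
      have e2 := E1 k 0
      norm_num at e1 e2 ⊢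
      have := cross_I2 (γ := γ) (n := 2*k+2) (m := 0) (z := Q (k+1) 0) (a := Q (k+1) 1)
        (b := Q k 1) (d := Q (k+1) 1) (b' := Q k 2) (a' := Q (k+2) 0) h0 h2 le_rfl (by linarith)
        (by linarith) (pos _ _) (pos _ _) (by rw [bd]; ring)
        (by convert e1 using 1; ring) (by convert e2 using 1; ring)
      linear_combination this
    | succ m ih =>
      apply full
      have hm0 : (0:ℝ) ≤ m := Nat.cast_nonneg m
      have e1 := E1 (k+1) m
      have e2 := E1 k (m+1)
      push_cast at e1 e2 ⊢
      have := cross_I2 (γ := γ) (n := m+2*k+3) (m := m+1) (z := Q (k+1) (m+1))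
        (a := Q (k+1) (m+2))
        (b := Q k (m+2)) (d := Q (k+2) m) (b' := Q k (m+3)) (a' := Q (k+2) (m+1)) h0 h2
        (by linarith) (by linarith)
        (by linarith) (pos _ _) (pos _ _) ih.2.2
        (by convert e1 using 1; ring) (by convert e2 using 1; ring)
      linear_combination this
  have good : ∀ k : ℕ,
      (∀ m : ℕ, ((m:ℝ)+1+2*k) * (Q k (m+1) ^ 2 - Q k m * Q (k+1) m) * (Q k (m+2) + Q (k+1) m) =
        -((m+1) * (Q k (m+1) ^ 2 - Q k (m+2) * Q (k+1) m) * (Q k m + Q (k+1) m))) := by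
    intro k
    induction k with
    | zero =>
      intro m
      norm_num
      linear_combination (m+1:ℝ) * hdiag m
    | succ k ih =>
      intro m
      obtain ⟨hS, ha, hc⟩ := (main k ih).2 m
      have := X_b (pos _ _) (pos _ _) hS ha
      push_cast
      linear_combination this
  exact ⟨pos, rho, fun k => (main k (good k)).1, hdiag, fun k m => ((main k (good k)).2 m).1,
    fun k m => ((main k (good k)).2 m).2.1, fun k m => ((main k (good k)).2 m).2.2⟩

def st (γ t : ℝ) : ℕ → ℝ × ℝ
  | 0 => (t, γ / ((2-γ)*t))
  | n+1 =>
    let x := (st γ t n).1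
    let y := (st γ t n).2
    let x' := (1+2*x*y-y^2)/(x*y^2+2*y-x)
    (x', (γ*x'+(2*n+2+γ)*y)/(x'*((2*n+4-γ)*x'+(2-γ)*y)))

def sN (γ : ℝ) (n : ℕ) (t : ℝ) : ℝ := 1+2*(st γ t n).1*(st γ t n).2-(st γ t n).2^2
def sM (γ : ℝ) (n : ℕ) (t : ℝ) : ℝ := (st γ t n).1*(st γ t n).2^2+2*(st γ t n).2-(st γ t n).1

def sGood (γ : ℝ) (n : ℕ) (t : ℝ) : Prop := ∀ i < n, 0 < sN γ i t ∧ 0 < sM γ i t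

theorem st1_succ (γ t : ℝ) (n : ℕ) : (st γ t (n+1)).1 = sN γ n t / sM γ n t := by
  rw [st]; rfl
theorem st2_succ (γ t : ℝ) (n : ℕ) : (st γ t (n+1)).2 =
    (γ*(sN γ n t / sM γ n t)+(2*n+2+γ)*(st γ t n).2)/
    ((sN γ n t / sM γ n t)*((2*n+4-γ)*(sN γ n t / sM γ n t)+(2-γ)*(st γ t n).2)) := by
  rw [st]; rfl

theorem sGood_main {γ : ℝ} (h0 : 0 < γ) (h2 : γ < 2) (n : ℕ) : ∀ t : ℝ, 0 < t → sGood γ n t →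
    0 < (st γ t n).1 ∧ 0 < (st γ t n).2 ∧ ContinuousAt (fun s => (st γ s n).1) t ∧
    ContinuousAt (fun s => (st γ s n).2) t ∧ ∀ᶠ s in nhds t, sGood γ n s := by
  induction n with
  | zero =>
    intro t ht _
    have h3 : 0 < 2-γ := by linarith
    refine ⟨by simpa [st] using ht, by simp only [st]; positivity, ?_, ?_, ?_⟩
    · simp only [st]; fun_prop
    · simp only [st]
      exact ContinuousAt.div (by fun_prop) (by fun_prop) (by positivity)
    · exact Filter.Eventually.of_forall fun s i hi => absurd hi (by omega)
  | succ n ih =>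
    intro t ht hg
    have h3 : 0 < 2-γ := by linarith
    have h4 : 0 < 2*(n:ℝ)+4-γ := by have : (0:ℝ) ≤ n := Nat.cast_nonneg n; linarith
    obtain ⟨hx, hy, cx, cy, ev⟩ := ih t ht (fun i hi => hg i (by omega))
    obtain ⟨hN, hM⟩ := hg n (by omega)
    have cN : ContinuousAt (sN γ n) t := by
      unfold sN; fun_prop
    have cM : ContinuousAt (sM γ n) t := by
      unfold sM; fun_prop
    have cx' : ContinuousAt (fun s => sN γ n s / sM γ n s) t := cN.div cM hM.ne'
    have px' : 0 < sN γ n t / sM γ n t := by positivity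
    simp only [st1_succ, st2_succ]
    refine ⟨px', by positivity, cx', ?_, ?_⟩
    · refine ContinuousAt.div (by fun_prop) (by fun_prop) (by positivity)
    · filter_upwards [ev, cN.eventually (lt_mem_nhds hN), cM.eventually (lt_mem_nhds hM)]
        with s h5 h6 h7 i hi
      rcases Nat.lt_succ_iff_lt_or_eq.mp hi with h | h
      · exact h5 i h
      · subst h; exact ⟨h6, h7⟩

theorem sNM {γ : ℝ} {n : ℕ} {t : ℝ} (hx : 0 < (st γ t n).1) (hy : 0 < (st γ t n).2)
    (hN : sN γ n t ≤ 0) : 0 < sM γ n t := by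
  unfold sN at hN; unfold sM
  have : 1 < (st γ t n).2 := by
    by_contra h
    nlinarith [mul_pos hx hy]
  nlinarith [mul_pos hx hy]

def sL (γ : ℝ) : Set ℝ := {t | 0 < t ∧ ∃ n, sGood γ n t ∧ sN γ n t ≤ 0}
def sH (γ : ℝ) : Set ℝ := {t | 0 < t ∧ ∃ n, sGood γ n t ∧ sM γ n t ≤ 0}

theorem sGood_succ {γ : ℝ} {n : ℕ} {t : ℝ} (h : sGood γ n t) (hN : 0 < sN γ n t)
    (hM : 0 < sM γ n t) : sGood γ (n+1) t := by
  intro i hi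
  rcases Nat.lt_succ_iff_lt_or_eq.mp hi with h' | h'
  · exact h i h'
  · subst h'; exact ⟨hN, hM⟩

theorem sL_open {γ : ℝ} (h0 : 0 < γ) (h2 : γ < 2) : IsOpen (sL γ) := by
  rw [isOpen_iff_mem_nhds]
  rintro t ⟨ht, n, hg, hN⟩
  obtain ⟨hx, hy, cx, cy, ev⟩ := sGood_main h0 h2 n t ht hg
  have h3 : 0 < 2-γ := by linarith
  have hn : (0:ℝ) ≤ n := Nat.cast_nonneg n
  have hM := sNM hx hy hN
  have cN : ContinuousAt (sN γ n) t := by unfold sN; fun_prop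
  have cM : ContinuousAt (sM γ n) t := by unfold sM; fun_prop
  rcases hN.lt_or_eq with hN | hN
  · filter_upwards [ev, lt_mem_nhds ht, cN.eventually (gt_mem_nhds hN)] with s a b c
    exact ⟨b, n, a, le_of_lt c⟩
  · have cx' : ContinuousAt (fun s => sN γ n s / sM γ n s) t := cN.div cM hM.ne'
    have x0 : sN γ n t / sM γ n t = 0 := by rw [hN, zero_div]
    have cz : ContinuousAt (fun s => (γ*(sN γ n s / sM γ n s)+(2*n+2+γ)*(st γ s n).2)/
        (((2*n+4-γ)*(sN γ n s / sM γ n s)+(2-γ)*(st γ s n).2))) t := by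
      refine ContinuousAt.div (by fun_prop) (by fun_prop) ?_
      rw [x0]; simp only [mul_zero, zero_add]; positivity
    have cF : ContinuousAt (fun s => (sN γ n s / sM γ n s)^2 * (1 +
        2 * ((γ*(sN γ n s / sM γ n s)+(2*n+2+γ)*(st γ s n).2)/
        (((2*n+4-γ)*(sN γ n s / sM γ n s)+(2-γ)*(st γ s n).2)))) -
        ((γ*(sN γ n s / sM γ n s)+(2*n+2+γ)*(st γ s n).2)/
        (((2*n+4-γ)*(sN γ n s / sM γ n s)+(2-γ)*(st γ s n).2)))^2) t := by fun_prop
    have hF : (sN γ n t / sM γ n t)^2 * (1 +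
        2 * ((γ*(sN γ n t / sM γ n t)+(2*n+2+γ)*(st γ t n).2)/
        (((2*n+4-γ)*(sN γ n t / sM γ n t)+(2-γ)*(st γ t n).2)))) -
        ((γ*(sN γ n t / sM γ n t)+(2*n+2+γ)*(st γ t n).2)/
        (((2*n+4-γ)*(sN γ n t / sM γ n t)+(2-γ)*(st γ t n).2)))^2 < 0 := by
      rw [x0]; simp only [mul_zero, zero_add, ne_eq, OfNat.ofNat_ne_zero, not_false_eq_true,
        zero_pow, zero_mul, zero_sub, Left.neg_neg_iff]
      positivity
    filter_upwards [ev, lt_mem_nhds ht, cM.eventually (lt_mem_nhds hM),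
      cF.eventually (gt_mem_nhds hF), cy.eventually (lt_mem_nhds hy)] with s a b c d e
    rcases le_or_gt (sN γ n s) 0 with h | h
    · exact ⟨b, n, a, h⟩
    · refine ⟨b, n+1, sGood_succ a h c, ?_⟩
      rw [sN, st1_succ, st2_succ]
      have h4 : 0 < 2*(n:ℝ)+4-γ := by linarith
      have px : 0 < sN γ n s / sM γ n s := by positivity
      generalize sN γ n s / sM γ n s = x at *
      generalize (st γ s n).2 = y at *
      have hd : 0 < (2*n+4-γ)*x+(2-γ)*y := by positivity
      rw [← div_div, div_right_comm]
      generalize (γ*x+(2*n+2+γ)*y)/((2*n+4-γ)*x+(2-γ)*y) = z at *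
      have : x^2 * (1 + 2*x*(z/x) - (z/x)^2) = x^2*(1+2*z)-z^2 := by field_simp
      by_contra hh
      have := mul_pos (pow_pos px 2) (not_le.mp hh)
      linarith

theorem sH_open {γ : ℝ} (h0 : 0 < γ) (h2 : γ < 2) : IsOpen (sH γ) := by
  rw [isOpen_iff_mem_nhds]
  rintro t ⟨ht, n, hg, hM⟩
  obtain ⟨hx, hy, cx, cy, ev⟩ := sGood_main h0 h2 n t ht hg
  have h3 : 0 < 2-γ := by linarith
  have hn : (0:ℝ) ≤ n := Nat.cast_nonneg n
  have h4 : 0 < 2*(n:ℝ)+4-γ := by linarith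
  have hN : 0 < sN γ n t := by
    by_contra h; exact absurd (sNM hx hy (not_lt.mp h)) (not_lt.mpr hM)
  have cN : ContinuousAt (sN γ n) t := by unfold sN; fun_prop
  have cM : ContinuousAt (sM γ n) t := by unfold sM; fun_prop
  rcases hM.lt_or_eq with hM | hM
  · filter_upwards [ev, lt_mem_nhds ht, cM.eventually (gt_mem_nhds hM)] with s a b c
    exact ⟨b, n, a, le_of_lt c⟩
  · have cw : ContinuousAt (fun s => sM γ n s / sN γ n s) t := cM.div cN hN.ne'
    have w0 : sM γ n t / sN γ n t = 0 := by rw [hM, zero_div]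
    have cz : ContinuousAt (fun s => (γ*(sM γ n s / sN γ n s)+(2*n+2+γ)*(st γ s n).2*
        (sM γ n s / sN γ n s)^2)/
        (((2*n+4-γ)+(2-γ)*(st γ s n).2*(sM γ n s / sN γ n s)))) t := by
      refine ContinuousAt.div (by fun_prop) (by fun_prop) ?_
      rw [w0]; simp only [mul_zero, add_zero]; positivity
    have cF : ContinuousAt (fun s => ((γ*(sM γ n s / sN γ n s)+(2*n+2+γ)*(st γ s n).2*
        (sM γ n s / sN γ n s)^2)/
        (((2*n+4-γ)+(2-γ)*(st γ s n).2*(sM γ n s / sN γ n s))))^2 +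
        2*((γ*(sM γ n s / sN γ n s)+(2*n+2+γ)*(st γ s n).2*
        (sM γ n s / sN γ n s)^2)/
        (((2*n+4-γ)+(2-γ)*(st γ s n).2*(sM γ n s / sN γ n s))))*(sM γ n s / sN γ n s) - 1) t := by
      fun_prop
    have hF : ((γ*(sM γ n t / sN γ n t)+(2*n+2+γ)*(st γ t n).2*
        (sM γ n t / sN γ n t)^2)/
        (((2*n+4-γ)+(2-γ)*(st γ t n).2*(sM γ n t / sN γ n t))))^2 +
        2*((γ*(sM γ n t / sN γ n t)+(2*n+2+γ)*(st γ t n).2*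
        (sM γ n t / sN γ n t)^2)/
        (((2*n+4-γ)+(2-γ)*(st γ t n).2*(sM γ n t / sN γ n t))))*(sM γ n t / sN γ n t) - 1 < 0 := by
      rw [w0]; norm_num
    filter_upwards [ev, lt_mem_nhds ht, cN.eventually (lt_mem_nhds hN),
      cF.eventually (gt_mem_nhds hF), cy.eventually (lt_mem_nhds hy)] with s a b c d e
    rcases le_or_gt (sM γ n s) 0 with h | h
    · exact ⟨b, n, a, h⟩
    · refine ⟨b, n+1, sGood_succ a c h, ?_⟩
      rw [sM, st1_succ, st2_succ]
      have pw : 0 < sM γ n s / sN γ n s := by positivity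
      have hinv : sN γ n s / sM γ n s = (sM γ n s / sN γ n s)⁻¹ := by rw [inv_div]
      rw [hinv]
      generalize sM γ n s / sN γ n s = w at *
      generalize (st γ s n).2 = y at *
      have hd : 0 < (2*n+4-γ)+(2-γ)*y*w := by positivity
      have hz : (γ*w⁻¹+(2*n+2+γ)*y)/(w⁻¹*((2*n+4-γ)*w⁻¹+(2-γ)*y)) =
          (γ*w+(2*n+2+γ)*y*w^2)/((2*n+4-γ)+(2-γ)*y*w) := by
        have : 0 < (2*n+4-γ)*w⁻¹+(2-γ)*y := by positivity
        rw [div_eq_div_iff (by positivity) (by positivity)]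
        field_simp
      rw [hz]
      generalize (γ*w+(2*n+2+γ)*y*w^2)/((2*n+4-γ)+(2-γ)*y*w) = z at *
      have : w * (w⁻¹*z^2+2*z-w⁻¹) = z^2+2*z*w-1 := by field_simp
      by_contra hh
      have := mul_pos pw (not_le.mp hh)
      linarith

theorem shoot {γ : ℝ} (h0 : 0 < γ) (h2 : γ < 2) : ∃ t : ℝ, 0 < t ∧ ∀ n, sGood γ n t := by
  by_contra hcon
  push Not at hcon
  have h3 : 0 < 2-γ := by linarith
  have hz : 0 < γ/(2-γ) := by positivity
  have e0 : ∀ t : ℝ, 0 < t → γ/((2-γ)*t) = γ/(2-γ)/t := fun t _ => by rw [div_div]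
  have cover : Set.Ioi (0:ℝ) ⊆ sL γ ∪ sH γ := by
    intro t ht
    obtain ⟨n, hn⟩ := hcon t ht
    have hex : ∃ n, ¬ sGood γ n t := ⟨n, hn⟩
    classical
    have h5 := Nat.find_spec hex
    have h6 := fun m (h : m < Nat.find hex) => Nat.find_min hex h
    generalize Nat.find hex = k at *
    rcases k with _ | k
    · exact absurd (fun i hi => absurd hi (by omega)) h5
    · have hg : sGood γ k t := not_not.mp (h6 k (by omega))
      by_cases hN : 0 < sN γ k t
      · by_cases hM : 0 < sM γ k t
        · exact absurd (sGood_succ hg hN hM) h5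
        · exact Or.inr ⟨ht, k, hg, not_lt.mp hM⟩
      · exact Or.inl ⟨ht, k, hg, not_lt.mp hN⟩
  have nL : (Set.Ioi (0:ℝ) ∩ sL γ).Nonempty := by
    set z := γ/(2-γ) with hzd
    have hzz : 0 < z/(1+z) := by positivity
    refine ⟨z/(1+z), hzz, hzz, 0, fun i hi => absurd hi (by omega), ?_⟩
    rw [sN]; simp only [st]
    rw [e0 _ hzz]
    have : z/(z/(1+z)) = 1+z := by field_simp
    rw [this]
    have h7 : 2*(z/(1+z))*(1+z) = 2*z := by field_simp
    rw [h7]; nlinarith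
  have nH : (Set.Ioi (0:ℝ) ∩ sH γ).Nonempty := by
    set z := γ/(2-γ) with hzd
    have hzz : 0 < 1+z := by positivity
    refine ⟨1+z, hzz, hzz, 0, fun i hi => absurd hi (by omega), ?_⟩
    rw [sM]; simp only [st]
    rw [e0 _ hzz]
    have h7 : (1+z)*(z/(1+z))^2+2*(z/(1+z))-(1+z) = -1/(1+z) := by field_simp; ring
    rw [h7]
    exact div_nonpos_of_nonpos_of_nonneg (by norm_num) hzz.le
  obtain ⟨t, ht, ⟨_, n, hg, hN⟩, ⟨_, m, hg', hM⟩⟩ := isPreconnected_Ioi (sL γ) (sH γ) (sL_open h0 h2) (sH_open h0 h2)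
    cover nL nH
  rcases lt_trichotomy n m with h | h | h
  · exact absurd (hg' n h).1 (not_lt.mpr hN)
  · subst h
    obtain ⟨hx, hy, -⟩ := sGood_main h0 h2 n t ht hg
    exact absurd (sNM hx hy hN) (not_lt.mpr hM)
  · exact absurd (hg m h).2 (not_lt.mpr hM)

theorem pat_exists {γ : ℝ} (h0 : 0 < γ) (h2 : γ < 2) : ∃ Q, Pat γ Q ∧ Q 0 0 = 1 := by
  obtain ⟨t, ht, hg⟩ := shoot h0 h2
  have h3 : 0 < 2-γ := by linarith
  have px : ∀ n, 0 < (st γ t n).1 := fun n => (sGood_main h0 h2 n t ht (hg n)).1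
  have py : ∀ n, 0 < (st γ t n).2 := fun n => (sGood_main h0 h2 n t ht (hg n)).2.1
  have ex : ∀ n, (st γ t (n+1)).1 * sM γ n t = sN γ n t := fun n => by
    rw [st1_succ]; exact div_mul_cancel₀ _ (hg (n+1) n (by omega)).2.ne'
  have ey : ∀ n : ℕ, (st γ t (n+1)).2 = (γ*(st γ t (n+1)).1+(2*n+2+γ)*(st γ t n).2)/
    ((st γ t (n+1)).1*((2*n+4-γ)*(st γ t (n+1)).1+(2-γ)*(st γ t n).2)) := fun n => by
    rw [st2_succ, ← st1_succ]
  have e0 : (st γ t 0).1 = t ∧ (st γ t 0).2 = γ / ((2-γ)*t) := by rw [st]; simp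
  unfold sM sN at ex
  generalize hX : (fun n => (st γ t n).1) = X
  generalize hY : (fun n => (st γ t n).2) = Y
  have gX : ∀ n, (st γ t n).1 = X n := fun n => congrFun hX n
  have gY : ∀ n, (st γ t n).2 = Y n := fun n => congrFun hY n
  simp only [gX, gY] at *
  clear hX hY gX gY
  set D : ℕ → ℝ := fun n => ∏ i ∈ Finset.range n, X i with hD
  have D0 : D 0 = 1 := by simp [hD]
  have Ds : ∀ n, D (n+1) = D n * X n := fun n => by simp [hD, Finset.prod_range_succ]
  have Dp : ∀ n, 0 < D n := fun n => Finset.prod_pos fun i _ => px i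
  clear_value D
  have hU : ∀ m, QQ γ D 1 m = Y m * D (m+1) := by
    intro m
    induction m with
    | zero =>
      rw [QQ, QQ, Ds, D0, e0.1, e0.2]
      have h3' := h3.ne'
      have ht' := ht.ne'
      push_cast
      rw [mul_zero, zero_add, zero_add, one_mul, one_mul, mul_comm (2-γ) t, ← div_div, div_mul_eq_mul_div,
        div_mul_cancel₀ _ ht']
    | succ m ih =>
      rw [QQ, QQ, QQ, ih, ey m, Ds (m+1)]
      have p1 := px (m+1); have p2 := py m; have p3 := Dp (m+1)
      have hm : (0:ℝ) ≤ m := Nat.cast_nonneg m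
      have h4 : (0:ℝ) < 2*m+4-γ := by linarith
      have h5 : 0 < (2*m+4-γ)*X (m+1)+(2-γ)*Y m := by positivity
      generalize X (m+1) = x at *
      generalize Y m = y at *
      generalize D (m+1) = d at *
      push_cast
      rw [div_mul_eq_mul_div, div_eq_div_iff]
      · ring
      · have : d * x * (2 * m + 2 * 0 + 4 - γ) + y * d * (2 * 0 + 2 - γ) = d * ((2*m+4-γ)*x+(2-γ)*y) := by ring
        rw [this]; positivity
      · positivity
  refine ⟨QQ γ D, QQ_pat h0 h2 Dp ?_, by rw [QQ, D0]⟩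
  intro m
  rw [hU, Ds (m+1), Ds m]
  linear_combination (-(D m)^3 * (X m)^2) * ex m

theorem prod_lim {s x : ℝ} (hs : 0 < s) (hx : 0 < x) (hsx : s + x = 1/2) (y : ℕ → ℝ)
    (hy : ∀ j : ℕ, y (j+1) * ((j+1-s)^2*(j+1+s)*(j+s)) = y j * ((j+1+x)*(j+1-x)^2*(j+x)))
    (hl : Filter.Tendsto y Filter.atTop (nhds 1)) :
    Real.sin (π*s)^2 * x = y 0 * Real.sin (π*x)^2 * s := by
  have key : ∀ j : ℕ, y j * (∏ i ∈ Finset.range j, (1 - s^2/((i:ℝ)+1)^2))^2 * ((j+x)*s) =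
      y 0 * (∏ i ∈ Finset.range j, (1 - x^2/((i:ℝ)+1)^2))^2 * ((j+s)*x) := by
    intro j
    induction j with
    | zero => simp; left; ring
    | succ j ih =>
      rw [Finset.prod_range_succ, Finset.prod_range_succ]
      have hj : (0:ℝ) ≤ j := Nat.cast_nonneg j
      have h1 : ∀ u : ℝ, 1 - u^2/((j:ℝ)+1)^2 = (j+1-u)*(j+1+u)/((j:ℝ)+1)^2 := by
        intro u; field_simp; ring
      rw [h1, h1, mul_pow, mul_pow]
      generalize (∏ i ∈ Finset.range j, (1 - s^2/((i:ℝ)+1)^2))^2 = A at *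
      generalize (∏ i ∈ Finset.range j, (1 - x^2/((i:ℝ)+1)^2))^2 = B at *
      have hyj := hy j
      push_cast
      rw [div_pow, div_pow]
      have p : 0 < ((j:ℝ)+s)*(j+x) := by positivity
      have q : (((j:ℝ)+1)^2)^2 ≠ 0 := by positivity
      have e : (((j:ℝ)+s)*(j+x)) * (y (j+1) * (A * ((j+1-s)*(j+1+s))^2) * ((j+1+x)*s)) =
          (((j:ℝ)+s)*(j+x)) * (y 0 * (B * ((j+1-x)*(j+1+x))^2) * ((j+1+s)*x)) := by
        linear_combination (A*(j+1+s)*(j+1+x)*s*(j+x)) * hyj +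
          ((j+1+x)^2*(j+1-x)^2*(j+x)*(j+1+s)) * ih
      have e2 := mul_left_cancel₀ p.ne' e
      linear_combination e2 / (((j:ℝ)+1)^2)^2
  have l1 := Real.tendsto_euler_sin_prod s
  have l2 := Real.tendsto_euler_sin_prod x
  have l3 : Filter.Tendsto (fun j : ℕ => ((j:ℝ)+x)/(j+s)) Filter.atTop (nhds 1) := by
    have : ∀ j : ℕ, ((j:ℝ)+x)/(j+s) = 1 + (x-s)/(j+s) := by
      intro j
      have : (0:ℝ) < j+s := by positivity
      field_simp; ring
    simp only [this]
    have h : Filter.Tendsto (fun j : ℕ => (x-s)/((j:ℝ)+s)) Filter.atTop (nhds 0) :=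
      Filter.Tendsto.div_atTop tendsto_const_nhds
        (Filter.tendsto_atTop_add_const_right _ _ tendsto_natCast_atTop_atTop)
    simpa using h.const_add 1
  have L1 := ((hl.mul (l1.pow 2)).mul_const x).mul l3
  have L2 := ((l2.pow 2).const_mul (y 0)).mul_const s
  have := tendsto_nhds_unique (L1.congr fun j => ?_) L2
  · linarith
  · have hj : (0:ℝ) < j+s := by positivity
    have k := key j
    rw [mul_div_assoc', div_eq_iff hj.ne']
    linear_combination (π^2*x*s) * k

theorem pat_t {γ : ℝ} (h0 : 0 < γ) (h2 : γ < 2) {Q : ℕ → ℕ → ℝ} (hP : Pat γ Q)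
    (h1 : Q 0 0 = 1) : Q 0 1 = Real.tan (γ*π/4) := by
  have pos := hP.pos
  have hρ : ∀ k : ℕ, Q (k+1) 0 * (2*k+2-γ) = Q k 0 * (2*k+γ) := fun k => by
    have hk : (0:ℝ) ≤ k := Nat.cast_nonneg k
    have : (0:ℝ) < 2*k+2-γ := by linarith
    rw [hP.rho k]; exact div_mul_cancel₀ _ this.ne'
  set y : ℕ → ℝ := fun k => Q k 1 ^ 2 / (Q k 0 * Q (k+1) 0) with hy
  have yp : ∀ k, 0 < y k := fun k => by
    have := pos k 1; have := pos k 0; have := pos (k+1) 0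
    simp only [hy]; positivity
  have yl : Filter.Tendsto y Filter.atTop (nhds 1) := by
    rw [← Filter.tendsto_add_atTop_iff_nat 2]
    have bd : ∀ k : ℕ, 1 - 3/(2*(k:ℝ)+5) ≤ y (k+2) ∧ y (k+2) ≤ 1 + 3/(2*(k:ℝ)+2) := by
      intro k
      have X := hP.Xa (k+1) 0
      have hr := hρ (k+2)
      have hk : (0:ℝ) ≤ k := Nat.cast_nonneg k
      have pA := pos (k+2) 0; have pB := pos (k+3) 0; have pb := pos (k+1) 2
      have pq := pos (k+2) 1
      norm_num at X hr
      have hY : y (k+2) * (Q (k+2) 0 * Q (k+3) 0) = Q (k+2) 1 ^ 2 := by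
        simp only [hy]; exact div_mul_cancel₀ _ (by positivity)
      have pY := yp (k+2)
      generalize y (k+2) = Y at *
      generalize Q (k+2) 0 = A at *
      generalize Q (k+3) 0 = B at *
      generalize Q (k+1) 2 = b at *
      generalize Q (k+2) 1 = q at *
      rw [← hY] at X
      have hBA : B ≤ 2 * A := by
        by_contra h
        push Not at h
        have : 0 < 2*((k:ℝ)+2)+2-γ := by linarith
        nlinarith [mul_pos pA (by linarith : (0:ℝ) < 2*(k:ℝ)+6-γ)]
      have hAB : A ≤ 2 * B := by
        by_contra h
        push Not at h
        have : 0 < 2*((k:ℝ)+2)+γ := by linarith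
        nlinarith
      have X2 : (2*(k:ℝ)+5)*(Y-1)*(B*(b+A)) = (Y*B-b)*(A+B) := by
        have : A * ((2*(k:ℝ)+5)*(Y-1)*(B*(b+A))) = A*((Y*B-b)*(A+B)) := by
          linear_combination X
        exact mul_left_cancel₀ pA.ne' this
      have hBb : 0 < B*(b+A) := by positivity
      have u1 : (2*(k:ℝ)+5)*(Y-1) ≤ 3*Y := by
        by_contra h
        push Not at h
        have := mul_lt_mul_of_pos_right h hBb
        rw [X2] at this
        nlinarith [mul_pos pY pB, mul_pos pY (mul_pos pB pb), mul_pos pb pA, mul_pos pb pB,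
          mul_nonneg (mul_pos pY pB).le (sub_nonneg.mpr hBA)]
      have u2 : -3 ≤ (2*(k:ℝ)+5)*(Y-1) := by
        by_contra h
        push Not at h
        have := mul_lt_mul_of_pos_right h hBb
        rw [X2] at this
        nlinarith [mul_pos pY pB, mul_pos pA pB, mul_pos (mul_pos pY pB) (add_pos pA pB), mul_nonneg pb.le (sub_nonneg.mpr hAB)]
      constructor
      · have : (2*(k:ℝ)+5) * (3/(2*(k:ℝ)+5)) = 3 := by field_simp
        by_contra h
        push Not at h
        have := mul_lt_mul_of_pos_left h (by positivity : 0 < 2*(k:ℝ)+5)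
        linarith
      · have : (2*(k:ℝ)+2) * (3/(2*(k:ℝ)+2)) = 3 := by field_simp
        by_contra h
        push Not at h
        have := mul_lt_mul_of_pos_left h (by positivity : 0 < 2*(k:ℝ)+2)
        linarith
    have lim : ∀ a : ℝ, Filter.Tendsto (fun k : ℕ => 3/(2*(k:ℝ)+a)) Filter.atTop (nhds 0) :=
      fun a => Filter.Tendsto.div_atTop tendsto_const_nhds
        (Filter.tendsto_atTop_add_const_right _ _
          (tendsto_natCast_atTop_atTop.const_mul_atTop (by norm_num)))
    refine tendsto_of_tendsto_of_tendsto_of_le_of_le (g := fun k : ℕ => 1 - 3/(2*(k:ℝ)+5))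
      (h := fun k : ℕ => 1 + 3/(2*(k:ℝ)+2)) ?_ ?_ (fun k => (bd k).1) (fun k => (bd k).2)
    · simpa using (lim 5).const_sub 1
    · simpa using (lim 2).const_add 1
  have yy : ∀ k : ℕ, y (k+1) * y k * ((2*k+2+γ)*(2*k+2-γ)) = (2*k+4-γ)*(2*k+γ) := by
    intro k
    have a := hρ k
    have b := hρ (k+1)
    have c := hP.bd k
    have p0 := pos k 0; have p1 := pos (k+1) 0; have p2 := pos (k+2) 0
    push_cast at b
    simp only [hy]
    rw [div_mul_div_comm, div_mul_eq_mul_div, div_eq_iff (by positivity)]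
    have : Q (k+1) 1 ^ 2 * Q k 1 ^ 2 = Q (k+1) 0 ^ 4 := by
      linear_combination (-Q (k+1) 0 ^ 2 - Q (k+1) 1 * Q k 1) * c
    rw [this]
    have e : (Q (k+1) 0 * (2*k+2-γ)) * (Q (k+1) 0 * (2*k+2+γ)) =
        (Q k 0 * (2*k+γ)) * (Q (k+2) 0 * (2*k+4-γ)) := by
      rw [a]; linear_combination (-(Q k 0 * (2*k+γ))) * b
    linear_combination (Q (k+1) 0 ^ 2) * e
  have step : ∀ j : ℕ, y (2*(j+1)) * ((j+1-γ/4)^2*(j+1+γ/4)*(j+γ/4)) =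
      y (2*j) * ((j+1+(1/2-γ/4))*(j+1-(1/2-γ/4))^2*(j+(1/2-γ/4))) := by
    intro j
    have a := yy (2*j)
    have b := yy (2*j+1)
    push_cast at a b
    have e : 2*(j+1) = 2*j+1+1 := by ring
    rw [e]
    have hj : (0:ℝ) ≤ j := Nat.cast_nonneg j
    have p : 0 < y (2*j+1) := yp _
    apply mul_left_cancel₀ (p.ne')
    have q : (0:ℝ) < (2*(2*j+1)+2+γ)*(2*(2*j+1)+2-γ)*((2*(2*j)+2+γ)*(2*(2*j)+2-γ)) := by
      have : (0:ℝ) < 2*(2*j+1)+2-γ := by linarith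
      have : (0:ℝ) < 2*(2*j)+2-γ := by linarith
      positivity
    apply mul_left_cancel₀ q.ne'
    linear_combination ((2*(2*j)+2+γ)*(2*(2*j)+2-γ))*((j+1-γ/4)^2*(j+1+γ/4)*(j+γ/4)) * b -
      (2*(2*j+1)+2+γ)*(2*(2*j+1)+2-γ)*((j+1+(1/2-γ/4))*(j+1-(1/2-γ/4))^2*(j+(1/2-γ/4))) * a
  have fin := prod_lim (s := γ/4) (x := 1/2-γ/4) (by positivity) (by linarith) (by ring)
    (fun j => y (2*j)) step (yl.comp (Filter.tendsto_atTop_mono (fun n => by simp only [id]; omega) Filter.tendsto_id))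
  have hx : Real.sin (π*(1/2-γ/4)) = Real.cos (π*(γ/4)) := by
    rw [← Real.sin_pi_div_two_sub]; ring_nf
  rw [hx] at fin
  have hy0 : y 0 * (γ/4) = Q 0 1 ^ 2 * (1/2-γ/4) := by
    have := hρ 0
    have p := pos 1 0
    simp only [hy]
    norm_num [h1] at this ⊢
    rw [div_mul_eq_mul_div, div_eq_iff p.ne']
    linear_combination -(Q 0 1^2) / 4 * this
  have hq := pos 0 1
  have pπ := Real.pi_pos
  have hang : π*(γ/4) = γ*π/4 := by ring
  have lt : γ*π/4 < π/2 := by nlinarith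
  have gt : 0 < γ*π/4 := by positivity
  rw [hang] at fin
  have hc : 0 < Real.cos (γ*π/4) := Real.cos_pos_of_mem_Ioo ⟨by linarith, lt⟩
  have hs : 0 < Real.sin (γ*π/4) := Real.sin_pos_of_pos_of_lt_pi gt (by linarith)
  have hxx : 0 < 1/2-γ/4 := by linarith
  simp only [mul_zero] at fin
  have e : Real.sin (γ*π/4)^2 = (Q 0 1 * Real.cos (γ*π/4))^2 := by
    apply mul_right_cancel₀ hxx.ne'
    linear_combination fin + Real.cos (γ*π/4)^2 * hy0
  have := (pow_left_inj₀ hs.le (by positivity) (by norm_num)).mp e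
  rw [Real.tan_eq_sin_div_cos, this]
  field_simp

def jj (x : ℝ) : ℝ := 2 * Real.arctan x - π/2

theorem jj_strictMono : StrictMono jj := fun a b h => by
  unfold jj; have := Real.arctan_strictMono h; linarith
theorem jj_one : jj 1 = 0 := by unfold jj; rw [Real.arctan_one]; ring
theorem jj_lt (x : ℝ) : jj x < π/2 := by
  unfold jj; have := Real.arctan_lt_pi_div_two x; linarith
theorem jj_inv {x : ℝ} (h : 0 < x) : jj x⁻¹ = - jj x := by
  unfold jj; rw [Real.arctan_inv_of_pos h]; ring
theorem jj_gt {x : ℝ} (h : 0 < x) : -(π/2) < jj x := by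
  unfold jj; have := Real.arctan_pos.mpr h; linarith
theorem jj_surj {d : ℝ} (h1 : -(π/2) < d) (h2 : d < π/2) : ∃ K, 0 < K ∧ jj K = d := by
  refine ⟨Real.tan ((d+π/2)/2), ?_, ?_⟩
  · have := Real.pi_pos
    exact Real.tan_pos_of_pos_of_lt_pi_div_two (by linarith) (by linarith)
  · unfold jj; rw [Real.arctan_tan (by linarith [Real.pi_pos]) (by linarith)]; ring

def MState (P : ℕ → ℕ → ℝ) (B : ℝ) (s : ℕ) (M K : ℝ) : Prop :=
  B ≤ M ∧ 1 < K ∧ (∀ k m, k + m = s → P k m ≤ M) ∧ ∃ k m, k + m = s + 1 ∧ M + jj K ≤ P k m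

theorem MState_step {Q P : ℕ → ℕ → ℝ} {B : ℝ} (pos : ∀ k m, 0 < Q k m)
    (t1 : ∀ k m, P k (m+1) = P (k+1) m + jj (Q (k+1) (m+1) / Q (k+1) m))
    (t2 : ∀ k m, P k (m+1) = P k m + jj (Q (k+1) m / Q k (m+1)))
    (h1 : ∀ k m, P (k+1) m < P k (m+2) → P (k+1) (m+1) ≤ P k (m+1))
    (h2 : ∀ k m, P k (m+1) < P (k+1) (m+1) → P k (m+2) ≤ P (k+1) m)
    (hB0 : ∀ k, P k 0 ≤ B) (hBm : ∀ m, P 0 m ≤ B) {s : ℕ} {M K : ℝ} (hS : MState P B s M K) :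
    ∃ M', M + jj K ≤ M' ∧ MState P B (s+1) M' (K^3) := by
  obtain ⟨hBM, hK, hle, k, m, hkm, hp⟩ := hS
  obtain ⟨p, hpm, hmax⟩ := (Finset.HasAntidiagonal.antidiagonal (s+1)).exists_max_image (fun q => P q.1 q.2)
    ⟨(k, m), by simpa using hkm⟩
  obtain ⟨k', m'⟩ := p
  have hp' := hmax (k, m) (by simpa using hkm)
  simp only [Finset.HasAntidiagonal.mem_antidiagonal, Prod.forall] at hpm hmax hp'
  have hj : 0 < jj K := by rw [← jj_one]; exact jj_strictMono hK
  have hK0 : 0 < K := by linarith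
  have hge : M + jj K ≤ P k' m' := hp.trans hp'
  refine ⟨P k' m', hge, by linarith, one_lt_pow₀ hK (by norm_num), hmax, k', m'+1, by omega, ?_⟩
  clear hp hp' hkm k m
  rcases k' with _ | k
  · have := hBm m'; linarith
  rcases m' with _ | m
  · have := hB0 (k+1); linarith
  have hi : P (k+1) m ≤ M := hle _ _ (by omega)
  have hq : P (k+2) m ≤ M := by
    rcases m with _ | m
    · exact (hB0 _).trans hBM
    · have := hle (k+2) m (by omega)
      exact (h1 (k+1) m (by show P (k+2) m < P (k+1) (m+2); linarith)).trans hi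
  have hq' : P k (m+2) ≤ M := by
    have := hle k (m+1) (by omega)
    exact (h2 k m (by linarith)).trans hi
  have e1 := t2 (k+1) m
  have e2 := t1 (k+1) m
  have e3 := t1 k (m+1)
  have e4 := t2 (k+1) (m+1)
  have p1 := pos (k+2) m; have p2 := pos (k+1) (m+1); have p3 := pos (k+2) (m+1)
  have p4 := pos (k+1) (m+2)
  simp only [show k+1+1 = k+2 from rfl, show m+1+1 = m+2 from rfl] at *
  have r1 : K * Q (k+1) (m+1) ≤ Q (k+2) m := by
    rw [← le_div_iff₀ p2]; exact jj_strictMono.le_iff_le.mp (by linarith)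
  have r2 : K * Q (k+2) m ≤ Q (k+2) (m+1) := by
    rw [← le_div_iff₀ p1]; exact jj_strictMono.le_iff_le.mp (by linarith)
  have r3 : K * Q (k+1) (m+2) ≤ Q (k+1) (m+1) := by
    rw [← le_div_iff₀ p4]
    apply jj_strictMono.le_iff_le.mp
    have := jj_inv (x := Q (k+1) (m+2) / Q (k+1) (m+1)) (by positivity)
    rw [inv_div] at this
    linarith
  have r4 : K^3 ≤ Q (k+2) (m+1) / Q (k+1) (m+2) := by
    rw [le_div_iff₀ p4]
    calc K^3 * Q (k+1) (m+2) = K * (K * (K * Q (k+1) (m+2))) := by ring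
      _ ≤ K * (K * Q (k+1) (m+1)) := by gcongr
      _ ≤ K * Q (k+2) m := by gcongr
      _ ≤ _ := r2
  have := jj_strictMono.le_iff_le.mpr r4
  linarith

theorem max_principle {Q P : ℕ → ℕ → ℝ} {B : ℝ} (pos : ∀ k m, 0 < Q k m)
    (t1 : ∀ k m, P k (m+1) = P (k+1) m + jj (Q (k+1) (m+1) / Q (k+1) m))
    (t2 : ∀ k m, P k (m+1) = P k m + jj (Q (k+1) m / Q k (m+1)))
    (h1 : ∀ k m, P (k+1) m < P k (m+2) → P (k+1) (m+1) ≤ P k (m+1))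
    (h2 : ∀ k m, P k (m+1) < P (k+1) (m+1) → P k (m+2) ≤ P (k+1) m)
    (hB0 : ∀ k, P k 0 ≤ B) (hBm : ∀ m, P 0 m ≤ B) (k m : ℕ) : P k m ≤ B := by
  have pπ := Real.pi_pos
  have ap1 : ∀ k m, P k m ≤ B + (π/2) * m := by
    intro k m
    induction m with
    | zero => simpa using hB0 k
    | succ m ih =>
      rw [t2]; have := jj_lt (Q (k+1) m / Q k (m+1)); push_cast; linarith
  have ap2 : ∀ k m, P k m ≤ B + (π/2) * k := by
    intro k
    induction k with
    | zero => intro m; simpa using hBm m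
    | succ k ih =>
      intro m
      have := t1 k m
      have := ih (m+1)
      have := jj_gt (div_pos (pos (k+1) (m+1)) (pos (k+1) m)); push_cast; linarith
  have up : ∀ s M K, MState P B s M K → M + jj K ≤ B + (π/4)*(s+1) := by
    rintro s M K ⟨_, _, _, k, m, hkm, h⟩
    have a := ap1 k m
    have b := ap2 k m
    have c : ((k:ℝ) + m) = s + 1 := by exact_mod_cast hkm
    rw [← c]; linarith
  have step := fun s M K (h : MState P B s M K) => MState_step pos t1 t2 h1 h2 hB0 hBm h
  have mono : ∀ s M K K', 1 < K' → K' ≤ K → MState P B s M K → MState P B s M K' := by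
    rintro s M K K' a b ⟨c, _, d, k, m, e, f⟩
    exact ⟨c, a, d, k, m, e, by have := jj_strictMono.le_iff_le.mpr b; linarith⟩
  have big : ∀ s M K, 3*π/8 ≤ jj K → ¬ MState P B s M K := by
    intro s M K hK h
    have : ∀ r : ℕ, ∃ M', M + r * (3*π/8) ≤ M' ∧ MState P B (s+r) M' K := by
      intro r
      induction r with
      | zero => exact ⟨M, by simp, h⟩
      | succ r ih =>
        obtain ⟨M', a, b⟩ := ih
        obtain ⟨M'', c, d⟩ := step _ _ _ b
        have hK1 := b.2.1
        refine ⟨M'', by push_cast; linarith, mono _ _ _ _ hK1 ?_ d⟩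
        exact le_self_pow₀ hK1.le (by norm_num)
    obtain ⟨M', a, b⟩ := this (2*s+3)
    have c := up _ _ _ b
    have d := h.1
    push_cast at a c
    nlinarith
  have none : ∀ s M K, ¬ MState P B s M K := by
    intro s M K h
    have hK1 := h.2.1
    have : ∀ r : ℕ, ∃ M', MState P B (s+r) M' (K^(r+1)) := by
      intro r
      induction r with
      | zero => exact ⟨M, by simpa using h⟩
      | succ r ih =>
        obtain ⟨M', b⟩ := ih
        obtain ⟨M'', c, d⟩ := step _ _ _ b
        refine ⟨M'', mono _ _ _ _ (one_lt_pow₀ hK1 (by omega)) ?_ d⟩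
        rw [← pow_mul]
        exact pow_le_pow_right₀ hK1.le (by omega)
    obtain ⟨X, hX, hj⟩ := jj_surj (d := 3*π/8) (by linarith) (by linarith)
    obtain ⟨r, hr⟩ := pow_unbounded_of_one_lt X hK1
    obtain ⟨M', b⟩ := this r
    refine big _ _ _ ?_ b
    rw [← hj]
    refine jj_strictMono.le_iff_le.mpr (hr.le.trans (pow_le_pow_right₀ hK1.le (by omega)))
  by_contra hcon
  have hex : ∃ s, ∃ k m, k + m = s ∧ B < P k m := ⟨k+m, k, m, rfl, not_le.mp hcon⟩
  classical
  have h5 := Nat.find_spec hex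
  have h6 := fun m (h : m < Nat.find hex) => Nat.find_min hex h
  generalize Nat.find hex = s at *
  obtain ⟨k, m, hkm, hlt⟩ := h5
  rcases s with _ | s
  · obtain ⟨rfl, rfl⟩ : k = 0 ∧ m = 0 := by omega
    have := hB0 0; linarith
  · have hd : 0 < min (P k m - B) (π/4) := lt_min (by linarith) (by linarith)
    have hd2 := min_le_right (P k m - B) (π/4)
    have hd3 := min_le_left (P k m - B) (π/4)
    obtain ⟨K, hK, hj⟩ := jj_surj (d := min (P k m - B) (π/4)) (by linarith) (by linarith)
    refine none s B K ⟨le_rfl, ?_, ?_, k, m, hkm, by linarith⟩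
    · apply jj_strictMono.lt_iff_lt.mp; rw [jj_one, hj]; exact hd
    · intro k' m' hs
      by_contra h
      exact h6 s (by omega) ⟨k', m', hs, not_le.mp h⟩

theorem arctan4 {R a b c d : ℝ} (hR : 0 < R) (ha : 0 < a) (hb : 0 < b) (hc : 0 < c) (hd : 0 < d)
    (hS : R^2*(a+b+c+d) = a*b*c + a*b*d + a*c*d + b*c*d) :
    jj (a/R) + jj (b/R) + jj (c/R) + jj (d/R) = 0 := by
  have sc : ∀ u : ℝ, Real.sin (Real.arctan u) = u * Real.cos (Real.arctan u) := by
    intro u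
    have h := Real.tan_arctan u
    rw [Real.tan_eq_sin_div_cos, div_eq_iff (Real.cos_arctan_pos u).ne'] at h
    exact h
  have pa := Real.arctan_pos.mpr (div_pos ha hR)
  have pb := Real.arctan_pos.mpr (div_pos hb hR)
  have pc := Real.arctan_pos.mpr (div_pos hc hR)
  have pd := Real.arctan_pos.mpr (div_pos hd hR)
  have la := Real.arctan_lt_pi_div_two (a/R)
  have lb := Real.arctan_lt_pi_div_two (b/R)
  have lc := Real.arctan_lt_pi_div_two (c/R)
  have ld := Real.arctan_lt_pi_div_two (d/R)
  have hs : Real.sin (Real.arctan (a/R) + Real.arctan (b/R) + (Real.arctan (c/R) +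
      Real.arctan (d/R))) = 0 := by
    rw [Real.sin_add, Real.sin_add, Real.cos_add, Real.sin_add, Real.cos_add, sc, sc, sc, sc]
    have e : (a/R)+(b/R)+(c/R)+(d/R) - ((a/R)*(b/R)*(c/R)+(a/R)*(b/R)*(d/R)+(a/R)*(c/R)*(d/R)
        +(b/R)*(c/R)*(d/R)) = 0 := by
      field_simp; linear_combination hS
    linear_combination (Real.cos (Real.arctan (a/R)) * Real.cos (Real.arctan (b/R)) *
      Real.cos (Real.arctan (c/R)) * Real.cos (Real.arctan (d/R))) * e
  have := (Real.sin_eq_zero_iff_of_lt_of_lt (x := Real.arctan (a/R) + Real.arctan (b/R) +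
    (Real.arctan (c/R) + Real.arctan (d/R)) - π) (by linarith) (by linarith)).mp
    (by rw [Real.sin_sub_pi, hs, neg_zero])
  unfold jj; linarith

theorem jj_div {x y : ℝ} (hx : 0 < x) (hy : 0 < y) : jj (x/y) = - jj (y/x) := by
  rw [← jj_inv (div_pos hy hx), inv_div]

def PP (Q : ℕ → ℕ → ℝ) (k : ℕ) : ℕ → ℝ
  | 0 => 0
  | m+1 => PP Q k m + jj (Q (k+1) m / Q k (m+1))

theorem PP_t1 {γ : ℝ} {Q : ℕ → ℕ → ℝ} (hP : Pat γ Q) (m : ℕ) : ∀ k,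
    PP Q k (m+1) = PP Q (k+1) m + jj (Q (k+1) (m+1) / Q (k+1) m) := by
  have pos := hP.pos
  induction m with
  | zero =>
    intro k
    have h := hP.bd k
    have p1 := pos (k+1) 0; have p2 := pos k 1
    simp only [PP]
    congr 2
    rw [zero_add, div_eq_div_iff (pos _ _).ne' (pos _ _).ne']; linarith
  | succ m ih =>
    intro k
    have h := arctan4 (pos (k+1) (m+1)) (pos _ _) (pos _ _) (pos _ _) (pos _ _) (hP.S k m)
    have e : PP Q k (m+2) = PP Q k (m+1) + jj (Q (k+1) (m+1) / Q k (m+2)) := rfl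
    have e2 : PP Q (k+1) (m+1) = PP Q (k+1) m + jj (Q (k+2) m / Q (k+1) (m+1)) := rfl
    have j1 := jj_div (pos (k+1) (m+1)) (pos (k+1) m)
    have j2 := jj_div (pos (k+1) (m+1)) (pos k (m+2))
    rw [e, e2, ih k]
    linarith

theorem PP_diag {γ : ℝ} (h0 : 0 < γ) (h2 : γ < 2) {Q : ℕ → ℕ → ℝ} (hP : Pat γ Q) (h1 : Q 0 0 = 1)
    (n : ℕ) : (γ-1)*π/2 - 2 * PP Q 0 n = jj (Q 0 (n+1) / Q 0 n) := by
  have pos := hP.pos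
  have pπ := Real.pi_pos
  induction n with
  | zero =>
    rw [zero_add, h1, div_one, pat_t h0 h2 hP h1, jj, Real.arctan_tan, PP]
    · ring
    · nlinarith
    · nlinarith
  | succ m ih =>
    have h := arctan4 (pos 0 (m+1)) (pos _ _) (pos _ _) (pos _ _) (pos _ _) (hP.diag m)
    have e : PP Q 0 (m+1) = PP Q 0 m + jj (Q 1 m / Q 0 (m+1)) := rfl
    have j1 := jj_div (pos 0 (m+1)) (pos 0 m)
    rw [e]
    linarith

theorem PP_sgn {γ : ℝ} {Q : ℕ → ℕ → ℝ} (hP : Pat γ Q) (k m : ℕ) :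
    (PP Q (k+1) m < PP Q k (m+2) → PP Q (k+1) (m+1) < PP Q k (m+1)) ∧
    (PP Q k (m+2) < PP Q (k+1) m → PP Q k (m+1) < PP Q (k+1) (m+1)) := by
  have pos := hP.pos
  have pR := pos (k+1) (m+1)
  have pa := pos (k+1) (m+2)
  have pb := pos k (m+2)
  have pd := pos (k+2) m
  have X := hP.Xc k m
  have e1 : PP Q k (m+2) = PP Q k (m+1) + jj (Q (k+1) (m+1) / Q k (m+2)) := rfl
  have e2 : PP Q (k+1) (m+1) = PP Q (k+1) m + jj (Q (k+2) m / Q (k+1) (m+1)) := rfl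
  have e3 : PP Q k (m+2) = PP Q (k+1) (m+1) + jj (Q (k+1) (m+2) / Q (k+1) (m+1)) := PP_t1 hP (m+1) k
  have e4 := jj_div pR pd
  have hn : (0:ℝ) < (m:ℝ)+2*k+3 := by positivity
  have hm : (0:ℝ) < (m:ℝ)+1 := by positivity
  generalize Q (k+1) (m+1) = R at *
  generalize Q (k+1) (m+2) = a at *
  generalize Q k (m+2) = b at *
  generalize Q (k+2) m = d at *
  have c1 : jj (R/b) < jj (a/R) ↔ R^2 < a*b := by
    rw [jj_strictMono.lt_iff_lt, div_lt_div_iff₀ pb pR, sq]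
  have c2 : jj (a/R) < jj (R/b) ↔ a*b < R^2 := by
    rw [jj_strictMono.lt_iff_lt, div_lt_div_iff₀ pR pb, sq]
  have c3 : jj (R/d) < jj (a/R) ↔ R^2 < a*d := by
    rw [jj_strictMono.lt_iff_lt, div_lt_div_iff₀ pd pR, sq]
  have c4 : jj (a/R) < jj (R/d) ↔ a*d < R^2 := by
    rw [jj_strictMono.lt_iff_lt, div_lt_div_iff₀ pR pd, sq]
  have pad : 0 < a + d := by positivity
  have pab : 0 < a + b := by positivity
  constructor
  · intro h
    have := c3.mp (by linarith)
    have := c1.mpr (by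
      by_contra hh
      have u1 := mul_nonneg (mul_nonneg hn.le (sub_nonneg.mpr (not_lt.mp hh))) pad.le
      have u2 := mul_pos (mul_pos hm (sub_pos.mpr this)) pab
      linarith)
    linarith
  · intro h
    have := c4.mp (by linarith)
    have := c2.mpr (by
      by_contra hh
      have u1 := mul_nonneg (mul_nonneg hn.le (sub_nonneg.mpr (not_lt.mp hh))) pad.le
      have u2 := mul_pos (mul_pos hm (sub_pos.mpr this)) pab
      linarith)
    linarith

theorem PP_bound {γ : ℝ} (h0 : 0 < γ) (h2 : γ < 2) {Q : ℕ → ℕ → ℝ} (hP : Pat γ Q) (h1 : Q 0 0 = 1)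
    (k m : ℕ) : (γ-1)*π/4 - π/4 ≤ PP Q k m ∧ PP Q k m ≤ (γ-1)*π/4 + π/4 := by
  have pos := hP.pos
  have pπ := Real.pi_pos
  have dg := PP_diag h0 h2 hP h1
  constructor
  · have := max_principle (Q := fun k m => (Q k m)⁻¹) (P := fun k m => - PP Q k m)
      (B := -((γ-1)*π/4) + π/4) (fun k m => inv_pos.mpr (pos k m))
      (fun k m => by
        have := PP_t1 hP m k
        have := jj_div (pos (k+1) (m+1)) (pos (k+1) m)
        rw [inv_div_inv]; linarith)
      (fun k m => by
        have : PP Q k (m+1) = PP Q k m + jj (Q (k+1) m / Q k (m+1)) := rfl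
        have := jj_div (pos (k+1) m) (pos k (m+1))
        rw [inv_div_inv]; linarith)
      (fun k m h => by
        have := (PP_sgn hP k m).2 (by linarith); linarith)
      (fun k m h => by
        by_contra hh
        have := (PP_sgn hP k m).2 (by linarith); linarith)
      (fun k => by simp only [PP]; nlinarith)
      (fun m => by
        have := dg m
        have := jj_lt (Q 0 (m+1) / Q 0 m); linarith) k m
    linarith
  · exact max_principle (Q := Q) (P := PP Q) (B := (γ-1)*π/4 + π/4) pos
      (fun k m => PP_t1 hP m k) (fun k m => rfl)
      (fun k m h => ((PP_sgn hP k m).1 h).le)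
      (fun k m h => by
        by_contra hh
        have := (PP_sgn hP k m).1 (by linarith); linarith)
      (fun k => by simp only [PP]; nlinarith)
      (fun m => by
        have := dg m
        have := jj_gt (div_pos (pos 0 (m+1)) (pos 0 m)); linarith) k m

/-- the full circle pattern data on the quadrant -/
structure Full (γ : ℝ) (R θ : ℕ → ℕ → ℝ) : Prop where
  pos : ∀ n m, 0 < R n m
  r0 : R 0 0 = 1
  rh : ∀ k : ℕ, R (2*k+2) 0 * (2*k+2-γ) = R (2*k) 0 * (2*k+γ)
  rv : ∀ k : ℕ, R 0 (2*k+2) * (2*k+2-γ) = R 0 (2*k) * (2*k+γ)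
  th : ∀ k, θ (2*k+1) 0 = 0
  tv : ∀ k, θ 0 (2*k+1) = (γ-1)*π/2
  t1 : ∀ n m, Even (n+m) → θ n (m+1) = θ (n+1) m + jj (R (n+1) (m+1) / R n m)
  t2 : ∀ n m, Odd (n+m) → θ (n+1) (m+1) = θ n m + jj (R (n+1) m / R n (m+1))
  lo : ∀ n m, (γ-1)*π/4 - π/4 ≤ θ n m
  hi : ∀ n m, θ n m ≤ (γ-1)*π/4 + π/4

theorem full_exists {γ : ℝ} (h0 : 0 < γ) (h2 : γ < 2) : ∃ R θ, Full γ R θ := by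
  obtain ⟨Q, hP, h1⟩ := pat_exists h0 h2
  have pos := hP.pos
  have dg := PP_diag h0 h2 hP h1
  have bdd := PP_bound h0 h2 hP h1
  have t1 := fun k m => PP_t1 hP m k
  have t2 : ∀ k m, PP Q k (m+1) = PP Q k m + jj (Q (k+1) m / Q k (m+1)) := fun k m => rfl
  have p0 : ∀ k, PP Q k 0 = 0 := fun k => rfl
  have hρ : ∀ k : ℕ, Q (k+1) 0 * (2*k+2-γ) = Q k 0 * (2*k+γ) := fun k => by
    have hk : (0:ℝ) ≤ k := Nat.cast_nonneg k
    have : (0:ℝ) < 2*k+2-γ := by linarith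
    rw [hP.rho k]; exact div_mul_cancel₀ _ this.ne'
  generalize PP Q = P at *
  set R : ℕ → ℕ → ℝ := fun n m => if m ≤ n then Q ((n-m)/2) m else Q ((m-n)/2) n with hR
  set θ : ℕ → ℕ → ℝ := fun n m => if m < n then P ((n-m-1)/2) m else
    (γ-1)*π/2 - P ((m-n-1)/2) n with hθ
  have R1 : ∀ k m n, n = m+2*k → R n m = Q k m := by
    rintro k m _ rfl
    simp only [hR]; rw [if_pos (by omega)]; congr 1; omega
  have R2 : ∀ k m n, m = n+2*k → R n m = Q k n := by
    rintro k _ n rfl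
    simp only [hR]
    split_ifs with h
    · obtain rfl : k = 0 := by omega
      simp
    · congr 1; omega
  have T1 : ∀ k m n, n = m+2*k+1 → θ n m = P k m := by
    rintro k m _ rfl
    simp only [hθ]; rw [if_pos (by omega)]; congr 1; omega
  have T2 : ∀ k m n, m = n+2*k+1 → θ n m = (γ-1)*π/2 - P k n := by
    rintro k _ n rfl
    simp only [hθ]; rw [if_neg (by omega)]; congr 2; omega
  refine ⟨R, θ, ?_, ?_, ?_, ?_, ?_, ?_, ?_, ?_, ?_, ?_⟩
  · intro n m; simp only [hR]; split_ifs <;> exact pos _ _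
  · rw [R1 0 0 0 (by omega), h1]
  · intro k; rw [R1 (k+1) 0 _ (by omega), R1 k 0 _ (by omega)]; exact hρ k
  · intro k; rw [R2 (k+1) _ 0 (by omega), R2 k _ 0 (by omega)]; exact hρ k
  · intro k; rw [T1 k _ _ (by omega), p0]
  · intro k; rw [T2 k _ _ (by omega), p0, sub_zero]
  · intro n m ⟨r, hr⟩
    rcases lt_trichotomy n m with h | h | h
    · obtain ⟨k, rfl⟩ : ∃ k, m = n+2*k+2 := ⟨(m-n-2)/2, by omega⟩
      rw [T2 (k+1) _ n (by omega), T2 k _ (n+1) (by omega), R2 (k+1) _ (n+1) (by omega),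
        R2 (k+1) _ n (by omega)]
      have := t1 k n; linarith
    · subst h
      rw [T2 0 _ n (by omega), T1 0 n _ (by omega), R1 0 _ _ (by omega), R1 0 _ _ (by omega)]
      have := dg n; linarith
    · obtain ⟨k, rfl⟩ : ∃ k, n = m+2*k+2 := ⟨(n-m-2)/2, by omega⟩
      rw [T1 k _ _ (by omega), T1 (k+1) _ _ (by omega), R1 (k+1) _ _ (by omega),
        R1 (k+1) _ _ (by omega)]
      exact t1 k m
  · intro n m ⟨r, hr⟩
    rcases lt_trichotomy n m with h | h | h
    · obtain ⟨k, rfl⟩ : ∃ k, m = n+2*k+1 := ⟨(m-n-1)/2, by omega⟩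
      rw [T2 k _ _ (by omega), T2 k _ n (by omega), R2 k _ (n+1) (by omega),
        R2 (k+1) _ n (by omega), jj_div (pos _ _) (pos _ _)]
      have := t2 k n; linarith
    · omega
    · obtain ⟨k, rfl⟩ : ∃ k, n = m+2*k+1 := ⟨(n-m-1)/2, by omega⟩
      rw [T1 k _ _ (by omega), T1 k _ _ (by omega), R1 (k+1) _ _ (by omega),
        R1 k _ _ (by omega)]
      exact t2 k m
  · intro n m; simp only [hθ]; split_ifs
    · exact (bdd _ _).1
    · have := (bdd ((m-n-1)/2) n).2; linarith
  · intro n m; simp only [hθ]; split_ifs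
    · exact (bdd _ _).2
    · have := (bdd ((m-n-1)/2) n).1; linarith

theorem bd_step {F u v : ℂ} {n : ℂ} (hF : F ≠ 0) (h : F = 2*n*(u*v)/(u+v)) :
    u * (2*n*v - F) = F * v := by
  have huv : u + v ≠ 0 := by
    intro h0; rw [h0, div_zero] at h; exact hF h
  rw [eq_div_iff huv] at h
  linear_combination -h

theorem bd_seq {γ : ℝ} (h0 : 0 < γ) (h2 : γ < 2) {g : ℕ → ℂ} {e : ℂ} (he : e ≠ 0) (g0 : g 0 = 0)
    (g1 : g 1 = e) (hg : ∀ n : ℕ, (γ:ℂ) * g n = 2 * (n:ℂ) * ((g (n+1) - g n) * (g n - g (n-1))) /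
      (g (n+1) - g (n-1))) {r : ℕ → ℝ} (rp : ∀ k, 0 < r k) (r0 : r 0 = 1)
    (hr : ∀ k : ℕ, r (k+1) * (2*k+2-γ) = r k * (2*k+γ)) (k : ℕ) :
    (γ:ℂ) * g (2*k) = 2*k*r k*e ∧ g (2*k+1) - g (2*k) = r k * e ∧
      g (2*k+2) - g (2*k+1) = r (k+1) * e := by
  have hrC : ∀ k : ℕ, (r (k+1) : ℂ) * (2*k+2-γ) = r k * (2*k+γ) := fun k => by
    exact_mod_cast hr k
  have odd : ∀ k : ℕ, (γ:ℂ) * g (2*k) = 2*k*r k*e → g (2*k+1) - g (2*k) = r k * e →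
      g (2*k+2) - g (2*k+1) = r (k+1) * e := by
    intro k a b
    have hk : (0:ℝ) ≤ k := Nat.cast_nonneg k
    have c := hg (2*k+1)
    have hF : (γ:ℂ) * g (2*k+1) = (2*k+γ)*r k*e := by linear_combination a + γ * b
    have p1 : ((2*k+γ : ℝ):ℂ) ≠ 0 := by exact_mod_cast (by positivity : (2*k+γ : ℝ) ≠ 0)
    have p2 : ((2*k+2-γ : ℝ):ℂ) ≠ 0 := by
      exact_mod_cast (by linarith : (0:ℝ) < (2*k+2-γ : ℝ)).ne'
    have p3 : (r k : ℂ) ≠ 0 := by exact_mod_cast (rp k).ne'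
    push_cast at p1 p2
    have s := bd_step (F := γ * g (2*k+1)) (u := g (2*k+2) - g (2*k+1)) (v := g (2*k+1) - g (2*k))
      (n := ((2*k+1 : ℕ):ℂ)) (by rw [hF]; exact mul_ne_zero (mul_ne_zero p1 p3) he)
      (by rw [c]; congr 1; simp)
    rw [hF, b] at s
    push_cast at s
    apply mul_right_cancel₀ (mul_ne_zero (mul_ne_zero p2 p3) he)
    linear_combination s - r k * e * e * hrC k
  have main : (γ:ℂ) * g (2*k) = 2*k*r k*e ∧ g (2*k+1) - g (2*k) = r k * e := by
    induction k with
    | zero => simp [g0, g1, r0]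
    | succ k ih =>
      obtain ⟨a, b⟩ := ih
      have d := odd k a b
      have hF : (γ:ℂ) * g (2*k+2) = (2*k+2)*r (k+1)*e := by
        linear_combination a + γ * b + γ * d - e * hrC k
      have c := hg (2*k+2)
      have p1 : ((2*k+2 : ℝ):ℂ) ≠ 0 := by exact_mod_cast (by positivity : (2*k+2 : ℝ) ≠ 0)
      have p3 : (r (k+1) : ℂ) ≠ 0 := by exact_mod_cast (rp (k+1)).ne'
      push_cast at p1
      have s := bd_step (F := γ * g (2*k+2)) (u := g (2*k+3) - g (2*k+2))
        (v := g (2*k+2) - g (2*k+1))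
        (n := ((2*k+2 : ℕ):ℂ)) (by rw [hF]; exact mul_ne_zero (mul_ne_zero p1 p3) he)
        (by rw [c]; congr 1; simp)
      rw [hF, d] at s
      push_cast at s
      have e1 : 2*(k+1) = 2*k+2 := by ring
      rw [e1]
      refine ⟨by rw [hF]; push_cast; ring, ?_⟩
      apply mul_right_cancel₀ (mul_ne_zero (mul_ne_zero p1 p3) he)
      linear_combination s
  exact ⟨main.1, main.2, odd k main.1 main.2⟩

theorem quad_close {h v h' v' h0 v0 : ℂ} (hh : h ≠ 0) (hv : v ≠ 0) (a : h + v' = v + h')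
    (b : h * h' = - (v * v')) (a0 : h + v0 = v + h0) (b0 : h * h0 = - (v * v0)) :
    h' = h0 ∧ v' = v0 := by
  have e : (h + v') * (h + v) = 2*h*v := by linear_combination h * a + b
  have e0 : (h + v0) * (h + v) = 2*h*v := by linear_combination h * a0 + b0
  have hs : h + v ≠ 0 := by
    intro hz; rw [hz, mul_zero] at e
    exact mul_ne_zero (mul_ne_zero two_ne_zero hh) hv e.symm
  have := mul_right_cancel₀ hs (e.trans e0.symm)
  have hv' : v' = v0 := add_left_cancel this
  refine ⟨?_, hv'⟩
  linear_combination a0 - a + hv'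

theorem exp_jj {a b : ℝ} (ha : 0 < a) (hb : 0 < b) :
    cexp ((jj (a/b) : ℝ) * I) * (a + b * I) = b + a * I := by
  have sc : Real.sin (Real.arctan (a/b)) = (a/b) * Real.cos (Real.arctan (a/b)) := by
    have h := Real.tan_arctan (a/b)
    rw [Real.tan_eq_sin_div_cos, div_eq_iff (Real.cos_arctan_pos _).ne'] at h
    exact h
  have one := Real.sin_sq_add_cos_sq (Real.arctan (a/b))
  have hS : Real.sin (jj (a/b)) = -Real.cos (2 * Real.arctan (a/b)) := by
    unfold jj; rw [Real.sin_sub_pi_div_two]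
  have hC : Real.cos (jj (a/b)) = Real.sin (2 * Real.arctan (a/b)) := by
    unfold jj; rw [Real.cos_sub_pi_div_two]
  rw [Real.cos_two_mul] at hS
  rw [Real.sin_two_mul] at hC
  rw [Complex.exp_mul_I, ← Complex.ofReal_cos, ← Complex.ofReal_sin]
  generalize Real.sin (jj (a/b)) = S at *
  generalize Real.cos (jj (a/b)) = C at *
  generalize Real.sin (Real.arctan (a/b)) = s at *
  generalize Real.cos (Real.arctan (a/b)) = c at *
  have e1 : b * s = a * c := by rw [sc]; field_simp
  apply Complex.ext
  · simp
    rw [hS, hC]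
    linear_combination -2*s*e1 + 2*b*one
  · simp
    rw [hS, hC]
    linear_combination 2*c*e1

structure Edges (f : ℕ → ℕ → ℂ) (R θ : ℕ → ℕ → ℝ) (n m : ℕ) : Prop where
  hE : Even (n+m) → f (n+1) m - f n m = R n m * cexp (θ (n+1) m * I)
  hO : Odd (n+m) → f (n+1) m - f n m = R (n+1) m * cexp (θ n m * I)
  vE : Even (n+m) → f n (m+1) - f n m = R n m * (I * cexp (θ n (m+1) * I))
  vO : Odd (n+m) → f n (m+1) - f n m = R n (m+1) * (I * cexp (θ n m * I))

theorem quad_step {γ : ℝ} {f : ℕ → ℕ → ℂ} {R θ : ℕ → ℕ → ℝ} (hF : Full γ R θ)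
    (hq : CrossRatioEq f) {n m : ℕ} (hE : Edges f R θ n m) :
    ((Even (n+m) → f (n+1) (m+1) - f n (m+1) = R (n+1) (m+1) * cexp (θ n (m+1) * I)) ∧
     (Odd (n+m) → f (n+1) (m+1) - f n (m+1) = R n (m+1) * cexp (θ (n+1) (m+1) * I))) ∧
    ((Even (n+m) → f (n+1) (m+1) - f (n+1) m = R (n+1) (m+1) * (I * cexp (θ (n+1) m * I))) ∧
     (Odd (n+m) → f (n+1) (m+1) - f (n+1) m = R (n+1) m * (I * cexp (θ (n+1) (m+1) * I)))) := by
  have pos := hF.pos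
  have hR : ∀ n m, (R n m : ℂ) ≠ 0 := fun n m => by exact_mod_cast (pos n m).ne'
  have q := hq n m
  have hden : ((f (n + 1) m - f (n + 1) (m + 1)) * (f n (m + 1) - f n m)) ≠ 0 := by
    intro h; rw [h, div_zero] at q; norm_num at q
  rw [div_eq_iff hden] at q
  have I2 : I * I = -1 := Complex.I_mul_I
  rcases Nat.even_or_odd (n+m) with he | ho
  · have hno : ¬ Odd (n+m) := Nat.not_odd_iff_even.mpr he
    have a := hE.hE he
    have b := hE.vE he
    have t := hF.t1 n m he
    have ej := exp_jj (pos (n+1) (m+1)) (pos n m)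
    have hw : cexp (θ n (m+1) * I) = cexp (θ (n+1) m * I) * cexp ((jj (R (n+1) (m+1) / R n m) : ℝ) * I) := by
      rw [← Complex.exp_add, t]; push_cast; congr 1; ring
    have hp := Complex.exp_ne_zero (θ (n+1) m * I)
    have hqe := Complex.exp_ne_zero (θ n (m+1) * I)
    generalize cexp ((jj (R (n+1) (m+1) / R n m) : ℝ) * I) = E at *
    generalize cexp (θ n (m+1) * I) = wq at *
    generalize cexp (θ (n+1) m * I) = wp at *
    have c := quad_close (h := f (n+1) m - f n m) (v := f n (m+1) - f n m)
      (h' := f (n+1) (m+1) - f n (m+1)) (v' := f (n+1) (m+1) - f (n+1) m)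
      (h0 := R (n+1) (m+1) * wq) (v0 := R (n+1) (m+1) * (I * wp))
      (by rw [a]; exact mul_ne_zero (hR _ _) hp)
      (by rw [b]; exact mul_ne_zero (hR _ _) (mul_ne_zero Complex.I_ne_zero hqe))
      (by ring) (by linear_combination -q)
      (by rw [a, b, hw]; linear_combination (-wp) * ej)
      (by rw [a, b]; linear_combination (-(R n m * wp * R (n+1) (m+1) * wq : ℂ)) * I2 * (-1))
    exact ⟨⟨fun _ => c.1, fun h => absurd h hno⟩, ⟨fun _ => c.2, fun h => absurd h hno⟩⟩
  · have hno : ¬ Even (n+m) := Nat.not_even_iff_odd.mpr ho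
    have a := hE.hO ho
    have b := hE.vO ho
    have t := hF.t2 n m ho
    have ej := exp_jj (pos (n+1) m) (pos n (m+1))
    have hw : cexp (θ (n+1) (m+1) * I) = cexp (θ n m * I) * cexp ((jj (R (n+1) m / R n (m+1)) : ℝ) * I) := by
      rw [← Complex.exp_add, t]; push_cast; congr 1; ring
    have hp := Complex.exp_ne_zero (θ n m * I)
    have hqe := Complex.exp_ne_zero (θ (n+1) (m+1) * I)
    generalize cexp ((jj (R (n+1) m / R n (m+1)) : ℝ) * I) = E at *
    generalize cexp (θ (n+1) (m+1) * I) = wq at *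
    generalize cexp (θ n m * I) = wp at *
    have c := quad_close (h := f (n+1) m - f n m) (v := f n (m+1) - f n m)
      (h' := f (n+1) (m+1) - f n (m+1)) (v' := f (n+1) (m+1) - f (n+1) m)
      (h0 := R n (m+1) * wq) (v0 := R (n+1) m * (I * wq))
      (by rw [a]; exact mul_ne_zero (hR _ _) hp)
      (by rw [b]; exact mul_ne_zero (hR _ _) (mul_ne_zero Complex.I_ne_zero hp))
      (by ring) (by linear_combination -q)
      (by rw [a, b, hw]; linear_combination (I*wp) * ej - (E * wp * R n (m+1) - wp * R (n+1) m) * I2)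
      (by rw [a, b]; linear_combination ((R (n+1) m * wp * R n (m+1) * wq : ℂ)) * I2)
    exact ⟨⟨fun h => absurd h hno, fun _ => c.1⟩, ⟨fun h => absurd h hno, fun _ => c.2⟩⟩

theorem edges_all {γ : ℝ} (h0 : 0 < γ) (h2 : γ < 2) {f : ℕ → ℕ → ℂ} {R θ : ℕ → ℕ → ℝ}
    (hF : Full γ R θ) (hq : CrossRatioEq f) (hc : ConstraintC γ f)
    (hinit : InitialData f (γ * Real.pi / 2)) : ∀ n m, Edges f R θ n m := by
  obtain ⟨i0, i1, i2⟩ := hinit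
  have bh := bd_seq h0 h2 (g := fun n => f n 0) (e := 1) one_ne_zero i0 i1
    (fun n => by have := hc n 0; simpa using this)
    (r := fun k => R (2*k) 0) (fun k => hF.pos _ _) hF.r0 hF.rh
  have bv := bd_seq h0 h2 (g := fun m => f 0 m) (e := I * cexp (((γ-1)*π/2 : ℝ) * I))
    (mul_ne_zero Complex.I_ne_zero (Complex.exp_ne_zero _)) i0
    (by
      show f 0 1 = _
      rw [i2]
      nth_rw 2 [← Complex.exp_pi_div_two_mul_I]
      rw [← Complex.exp_add]; congr 1; push_cast; ring)
    (fun n => by have := hc 0 n; simpa using this)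
    (r := fun k => R 0 (2*k)) (fun k => hF.pos _ _) hF.r0 hF.rv
  have H0 : ∀ n, (Even (n+0) → f (n+1) 0 - f n 0 = R n 0 * cexp (θ (n+1) 0 * I)) ∧
      (Odd (n+0) → f (n+1) 0 - f n 0 = R (n+1) 0 * cexp (θ n 0 * I)) := by
    intro n
    constructor
    · rintro ⟨r, hr⟩
      obtain rfl : n = 2*r := by omega
      rw [hF.th]; simpa using (bh r).2.1
    · rintro ⟨r, hr⟩
      obtain rfl : n = 2*r+1 := by omega
      rw [hF.th, Complex.ofReal_zero, zero_mul, Complex.exp_zero]; exact (bh r).2.2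
  have V0 : ∀ m, (Even (0+m) → f 0 (m+1) - f 0 m = R 0 m * (I * cexp (θ 0 (m+1) * I))) ∧
      (Odd (0+m) → f 0 (m+1) - f 0 m = R 0 (m+1) * (I * cexp (θ 0 m * I))) := by
    intro n
    constructor
    · rintro ⟨r, hr⟩
      obtain rfl : n = 2*r := by omega
      rw [hF.tv]; exact (bv r).2.1
    · rintro ⟨r, hr⟩
      obtain rfl : n = 2*r+1 := by omega
      rw [hF.tv]; exact (bv r).2.2
  have row : ∀ m, (∀ n, (Even (n+m) → f (n+1) m - f n m = R n m * cexp (θ (n+1) m * I)) ∧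
      (Odd (n+m) → f (n+1) m - f n m = R (n+1) m * cexp (θ n m * I))) →
      ∀ n, Edges f R θ n m := by
    intro m hm n
    induction n with
    | zero => exact ⟨(hm 0).1, (hm 0).2, (V0 m).1, (V0 m).2⟩
    | succ n ih =>
      have s := (quad_step hF hq ih).2
      refine ⟨(hm _).1, (hm _).2, fun h => s.2 ?_, fun h => s.1 ?_⟩
      · rcases Nat.even_or_odd (n+m) with h' | h'
        · obtain ⟨a, ha⟩ := h; obtain ⟨b, hb⟩ := h'; omega
        · exact h'
      · rcases Nat.even_or_odd (n+m) with h' | h'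
        · exact h'
        · obtain ⟨a, ha⟩ := h; obtain ⟨b, hb⟩ := h'; omega
  have all : ∀ m n, Edges f R θ n m := by
    intro m
    induction m with
    | zero => exact row 0 H0
    | succ m ih =>
      apply row
      intro n
      have s := (quad_step hF hq (ih n)).1
      refine ⟨fun h => s.2 ?_, fun h => s.1 ?_⟩
      · rcases Nat.even_or_odd (n+m) with h' | h'
        · obtain ⟨a, ha⟩ := h; obtain ⟨b, hb⟩ := h'; omega
        · exact h'
      · rcases Nat.even_or_odd (n+m) with h' | h'
        · exact h'
        · obtain ⟨a, ha⟩ := h; obtain ⟨b, hb⟩ := h'; omega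
  exact fun n m => all m n

def lf (φ : ℝ) (z : ℂ) : ℝ := Real.cos φ * z.re + Real.sin φ * z.im

theorem lf_sub (φ : ℝ) (z w : ℂ) : lf φ (z - w) = lf φ z - lf φ w := by
  simp [lf]; ring

theorem lf_h (φ r α : ℝ) : lf φ (r * cexp (α * I)) = r * Real.cos (α - φ) := by
  rw [Complex.exp_mul_I, ← Complex.ofReal_cos, ← Complex.ofReal_sin, Real.cos_sub]
  generalize Real.cos α = c
  generalize Real.sin α = s
  simp [lf]; ring

theorem lf_v (φ r α : ℝ) : lf φ (r * (I * cexp (α * I))) = r * Real.sin (φ - α) := by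
  rw [Complex.exp_mul_I, ← Complex.ofReal_cos, ← Complex.ofReal_sin, Real.sin_sub]
  generalize Real.cos α = c
  generalize Real.sin α = s
  simp [lf]; ring

theorem lf_conv (φ C : ℝ) : Convex ℝ {z | lf φ z ≤ C} := by
  intro x hx y hy a b ha hb hab
  simp only [Set.mem_setOf_eq, lf, Complex.add_re, Complex.add_im, Complex.real_smul,
    Complex.mul_re, Complex.mul_im, Complex.ofReal_re, Complex.ofReal_im] at *
  have h1 := mul_le_mul_of_nonneg_left hx ha
  have h2 := mul_le_mul_of_nonneg_left hy hb
  have : a * C + b * C = C := by rw [← add_mul, hab, one_mul]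
  linarith

theorem lf_pi (φ : ℝ) (z : ℂ) : lf (φ + π) z = - lf φ z := by
  simp [lf]; ring

theorem lf_int {φ C : ℝ} {S : Set ℂ} (hS : ∀ z ∈ S, lf φ z ≤ C) {z : ℂ}
    (hz : z ∈ interior (convexHull ℝ S)) : lf φ z < C := by
  have h1 : convexHull ℝ S ⊆ {z | lf φ z ≤ C} := convexHull_min hS (lf_conv φ C)
  have h2 := interior_mono h1 hz
  rw [mem_interior_iff_mem_nhds, Metric.mem_nhds_iff] at h2
  obtain ⟨ε, hε, hb⟩ := h2
  have h3 : z + ((ε/2 : ℝ):ℂ) * cexp (φ * I) ∈ Metric.ball z ε := by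
    rw [Metric.mem_ball, dist_eq_norm, add_sub_cancel_left, norm_mul, Complex.norm_exp_ofReal_mul_I,
      Complex.norm_real, Real.norm_of_nonneg (by linarith)]
    linarith
  have h4 := hb h3
  have h5 := lf_h φ (ε/2) φ
  have h6 := lf_sub φ (z + ((ε/2 : ℝ):ℂ) * cexp (φ * I)) z
  rw [add_sub_cancel_left, h5, sub_self, Real.cos_zero] at h6
  simp only [Set.mem_setOf_eq] at h4
  linarith

theorem quad_sep {f : ℕ → ℕ → ℂ} {n m n' m' : ℕ} (φ C : ℝ)
    (h1 : lf φ (f n m) ≤ C) (h2 : lf φ (f (n+1) m) ≤ C) (h3 : lf φ (f (n+1) (m+1)) ≤ C)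
    (h4 : lf φ (f n (m+1)) ≤ C)
    (k1 : C ≤ lf φ (f n' m')) (k2 : C ≤ lf φ (f (n'+1) m')) (k3 : C ≤ lf φ (f (n'+1) (m'+1)))
    (k4 : C ≤ lf φ (f n' (m'+1))) : Disjoint (quadInterior f n m) (quadInterior f n' m') := by
  rw [Set.disjoint_left]
  intro z hz hz'
  have a := lf_int (φ := φ) (C := C) (by
    rintro w (rfl | rfl | rfl | rfl) <;> assumption) hz
  have b := lf_int (φ := φ + π) (C := -C) (by
    rintro w (rfl | rfl | rfl | rfl) <;> rw [lf_pi] <;> linarith) hz'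
  rw [lf_pi] at b
  linarith

theorem emb {γ : ℝ} {f : ℕ → ℕ → ℂ} {R θ : ℕ → ℕ → ℝ}
    (hF : Full γ R θ) (hE : ∀ n m, Edges f R θ n m) : Embedded f := by
  have pos := hF.pos
  have lo := hF.lo
  have hi := hF.hi
  have pπ := Real.pi_pos
  obtain ⟨c, hc⟩ : ∃ c, c = (γ-1)*π/4 := ⟨_, rfl⟩
  rw [← hc] at lo hi
  have hh : ∀ n m, ∃ r α : ℝ, 0 < r ∧ c - π/4 ≤ α ∧ α ≤ c + π/4 ∧
      f (n+1) m - f n m = r * cexp (α * I) := by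
    intro n m
    rcases Nat.even_or_odd (n+m) with h | h
    · exact ⟨_, _, pos _ _, lo _ _, hi _ _, (hE n m).hE h⟩
    · exact ⟨_, _, pos _ _, lo _ _, hi _ _, (hE n m).hO h⟩
  have hv : ∀ n m, ∃ r α : ℝ, 0 < r ∧ c - π/4 ≤ α ∧ α ≤ c + π/4 ∧
      f n (m+1) - f n m = r * (I * cexp (α * I)) := by
    intro n m
    rcases Nat.even_or_odd (n+m) with h | h
    · exact ⟨_, _, pos _ _, lo _ _, hi _ _, (hE n m).vE h⟩
    · exact ⟨_, _, pos _ _, lo _ _, hi _ _, (hE n m).vO h⟩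
  have monoH : ∀ φ, c - π/4 ≤ φ → φ ≤ c + π/4 → ∀ m, Monotone fun n => lf φ (f n m) := by
    intro φ a b m
    apply monotone_nat_of_le_succ
    intro n
    obtain ⟨r, α, hr, h1, h2, e⟩ := hh n m
    have := lf_sub φ (f (n+1) m) (f n m)
    rw [e, lf_h] at this
    have := mul_nonneg hr.le (Real.cos_nonneg_of_mem_Icc (x := α - φ) ⟨by linarith, by linarith⟩)
    linarith
  have monoV : ∀ φ, c + π/4 ≤ φ → φ ≤ c + 3*π/4 → ∀ n, Monotone fun m => lf φ (f n m) := by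
    intro φ a b n
    apply monotone_nat_of_le_succ
    intro m
    obtain ⟨r, α, hr, h1, h2, e⟩ := hv n m
    have := lf_sub φ (f n (m+1)) (f n m)
    rw [e, lf_v] at this
    have := mul_nonneg hr.le (Real.sin_nonneg_of_nonneg_of_le_pi (x := φ - α)
      (by linarith) (by linarith))
    linarith
  have antiV : ∀ n, Antitone fun m => lf (c - π/4) (f n m) := by
    intro n
    apply antitone_nat_of_succ_le
    intro m
    obtain ⟨r, α, hr, h1, h2, e⟩ := hv n m
    have := lf_sub (c - π/4) (f n (m+1)) (f n m)
    rw [e, lf_v] at this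
    have := mul_nonneg hr.le (Real.sin_nonneg_of_nonneg_of_le_pi (x := α - (c - π/4))
      (by linarith) (by linarith))
    rw [← neg_sub, Real.sin_neg] at this
    linarith
  have main : ∀ n m n' m' : ℕ, (n < n' ∨ (n = n' ∧ m < m')) →
      Disjoint (quadInterior f n m) (quadInterior f n' m') := by
    intro n m n' m' h
    rcases h with h | ⟨rfl, h⟩
    · rcases lt_trichotomy m m' with hm | hm | hm
      · have mh := monoH (c + π/4) (by linarith) le_rfl
        have mv := monoV (c + π/4) le_rfl (by linarith)
        have H : ∀ {a b a' b'}, a ≤ a' → b ≤ b' →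
            lf (c + π/4) (f a b) ≤ lf (c + π/4) (f a' b') :=
          fun {a b a' b'} h1 h2 => (mh b h1).trans (mv a' h2)
        refine quad_sep (c + π/4) (lf (c + π/4) (f (n+1) (m+1))) ?_ ?_ ?_ ?_ ?_ ?_ ?_ ?_ <;>
          apply H <;> omega
      · subst hm
        obtain ⟨r, α, h1, h2, e⟩ : ∃ r α : ℝ, c - π/4 ≤ α ∧ α ≤ c + π/4 ∧
          f (n+1) (m+1) - f (n+1) m = r * (I * cexp (α * I)) := by
          obtain ⟨r, α, _, h⟩ := hv (n+1) m
          exact ⟨r, α, h⟩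
        have mh := monoH α h1 h2
        have e2 := lf_sub α (f (n+1) (m+1)) (f (n+1) m)
        rw [e, lf_v, sub_self, Real.sin_zero, mul_zero] at e2
        have H : ∀ {a a' b}, a ≤ a' → lf α (f a b) ≤ lf α (f a' b) := fun {a a' b} h1 => mh b h1
        have e3 : lf α (f (n+1) m) = lf α (f (n+1) (m+1)) := by linarith
        refine quad_sep α (lf α (f (n+1) m)) ?_ le_rfl ?_ ?_ ?_ ?_ ?_ ?_
        · exact H (by omega)
        · exact e3.ge
        · rw [e3]; exact H (by omega)
        · exact H (by omega)
        · exact H (by omega)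
        · rw [e3]; exact H (by omega)
        · rw [e3]; exact H (by omega)
      · have mh := monoH (c - π/4) le_rfl (by linarith)
        have H : ∀ {a b a' b'}, a ≤ a' → b' ≤ b →
            lf (c - π/4) (f a b) ≤ lf (c - π/4) (f a' b') :=
          fun {a b a' b'} h1 h2 => (mh b h1).trans (antiV a' h2)
        refine quad_sep (c - π/4) (lf (c - π/4) (f (n+1) m)) ?_ ?_ ?_ ?_ ?_ ?_ ?_ ?_ <;>
          apply H <;> omega
    · obtain ⟨r, α, h1, h2, e⟩ : ∃ r α : ℝ, c - π/4 ≤ α ∧ α ≤ c + π/4 ∧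
        f (n+1) (m+1) - f n (m+1) = r * cexp (α * I) := by
        obtain ⟨r, α, _, h⟩ := hh n (m+1)
        exact ⟨r, α, h⟩
      have mv := monoV (α + π/2) (by linarith) (by linarith)
      have e2 := lf_sub (α + π/2) (f (n+1) (m+1)) (f n (m+1))
      rw [e, lf_h, sub_add_cancel_left, Real.cos_neg, Real.cos_pi_div_two, mul_zero] at e2
      have H : ∀ {a b b'}, b ≤ b' → lf (α + π/2) (f a b) ≤ lf (α + π/2) (f a b') :=
        fun {a b b'} h1 => mv a h1
      have e3 : lf (α + π/2) (f n (m+1)) = lf (α + π/2) (f (n+1) (m+1)) := by linarith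
      refine quad_sep (α + π/2) (lf (α + π/2) (f n (m+1))) ?_ ?_ ?_ le_rfl ?_ ?_ ?_ ?_
      · exact H (by omega)
      · rw [e3]; exact H (by omega)
      · exact e3.ge
      · exact H (by omega)
      · rw [e3]; exact H (by omega)
      · rw [e3]; exact H (by omega)
      · exact H (by omega)
  intro n m n' m' hne
  by_cases h : n < n' ∨ (n = n' ∧ m < m')
  · exact main _ _ _ _ h
  · refine (main _ _ _ _ ?_).symm
    by_contra h'
    apply hne
    ext <;> simp <;> omega


/-- For every `0 < γ < 2`, the discrete conformal map `Z^γ`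
(the solution of (q), (c) with the standard initial data) is embedded. -/
theorem stmt0 (γ : ℝ) (hγ0 : 0 < γ) (hγ2 : γ < 2)
    (f : ℕ → ℕ → ℂ) (hq : CrossRatioEq f) (hc : ConstraintC γ f)
    (hinit : InitialData f (γ * Real.pi / 2)) :
    Embedded f := by
  obtain ⟨R, θ, hF⟩ := full_exists hγ0 hγ2
  exact emb hF (edges_all hγ0 hγ2 hF hq hc hinit)
end
end

section
/- Let 0 < γ < 2 and 0 < α < π, and let f: ℤ≥0×ℤ≥0 → ℂ satisfy the cross-ratio equation (q) and the constraint (c) with initial data f(0,0)=0, f(1,0)=1, f(0,1)=e^{iα}. Then f has the equidistant property on the boundary: f(2n,0) − f(2n−1,0) = f(2n+1,0) − f(2n,0) for every n ≥ 1, and f(0,2m) − f(0,2m−1) = f(0,2m+1) − f(0,2m) for every m ≥ 1. -/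
open Complex Real

noncomputable section

theorem boundary_aux (γ : ℝ) (hγ0 : 0 < γ) (g : ℕ → ℂ) (h0 : g 0 = 0) (h1 : g 1 ≠ 0)
    (hc : ∀ n : ℕ, (γ : ℂ) * g n =
      2 * (n : ℂ) * ((g (n + 1) - g n) * (g n - g (n - 1))) / (g (n + 1) - g (n - 1))) :
    ∀ n : ℕ, 1 ≤ n → g (2 * n) - g (2 * n - 1) = g (2 * n + 1) - g (2 * n) := by
  have hγ : (γ : ℂ) ≠ 0 := by exact_mod_cast hγ0.ne'
  have hc' : ∀ n : ℕ, g (n + 1) ≠ 0 → (γ : ℂ) * g (n + 1) * (g (n + 2) - g n) =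
      2 * ((n : ℂ) + 1) * ((g (n + 2) - g (n + 1)) * (g (n + 1) - g n)) := by
    intro n hn
    have h := hc (n + 1)
    simp only [Nat.add_sub_cancel, Nat.cast_add, Nat.cast_one, add_assoc, Nat.reduceAdd] at h
    have hd : g (n + 2) - g n ≠ 0 := by
      intro hd
      rw [hd, div_zero] at h
      exact mul_ne_zero hγ hn h
    rw [h]
    field_simp
  have key : ∀ k : ℕ, (γ : ℂ) * g (2 * k + 1) = (2 * k + γ) * (g (2 * k + 1) - g (2 * k)) →
      g (2 * k + 1) ≠ 0 →
      (g (2 * k + 2) - g (2 * k + 1) = g (2 * k + 3) - g (2 * k + 2) ∧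
       (γ : ℂ) * g (2 * k + 3) = (2 * k + 2 + γ) * (g (2 * k + 3) - g (2 * k + 2)) ∧
       g (2 * k + 3) ≠ 0) := by
    intro k hk hb
    have hA := hc' (2 * k) hb
    have hB := hc' (2 * k + 1)
    simp only [add_assoc, Nat.reduceAdd] at hB
    generalize g (2 * k) = a at *
    generalize g (2 * k + 1) = b at *
    generalize g (2 * k + 2) = c at *
    generalize g (2 * k + 3) = h at *
    push_cast at hA hB
    have hp : (2 * (k : ℂ) + γ) ≠ 0 := by
      have : (2 * (k : ℝ) + γ) ≠ 0 := by positivity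
      exact_mod_cast this
    have hp2 : (2 * (k : ℂ) + 2) ≠ 0 := by
      have : (2 * (k : ℝ) + 2) ≠ 0 := by positivity
      exact_mod_cast this
    have hp3 : (2 * (k : ℂ) + 2 + γ) ≠ 0 := by
      have : (2 * (k : ℝ) + 2 + γ) ≠ 0 := by positivity
      exact_mod_cast this
    have hd : b - a ≠ 0 := by
      intro hd
      rw [hd, mul_zero] at hk
      exact mul_ne_zero hγ hb hk
    have e1 : (2 * (k : ℂ) + γ) * (b - a) = (2 * k + 2 - γ) * (c - b) := by
      apply mul_left_cancel₀ hd
      linear_combination hA - (c - a) * hk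
    have he : c - b ≠ 0 := by
      intro he
      rw [he, mul_zero] at e1
      exact mul_ne_zero hp hd e1
    have e2 : (γ : ℂ) * c = (2 * k + 2) * (c - b) := by
      linear_combination hk + e1
    have hcn : c ≠ 0 := by
      intro h0
      rw [h0, mul_zero] at e2
      rw [h0] at he
      exact mul_ne_zero hp2 he e2.symm
    have hB := hB hcn
    have e3 : c - b = h - c := by
      apply mul_left_cancel₀ (mul_ne_zero hp2 he)
      linear_combination hB - (h - b) * e2
    have e4 : (γ : ℂ) * h = (2 * k + 2 + γ) * (h - c) := by
      linear_combination e2 + (2 * (k : ℂ) + 2) * e3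
    refine ⟨e3, e4, ?_⟩
    intro h0
    rw [h0, mul_zero] at e4
    rw [h0] at e3
    rw [e3] at he
    exact mul_ne_zero hp3 he e4.symm
  have inv : ∀ k : ℕ, (γ : ℂ) * g (2 * k + 1) = (2 * k + γ) * (g (2 * k + 1) - g (2 * k)) ∧
      g (2 * k + 1) ≠ 0 := by
    intro k
    induction k with
    | zero => exact ⟨by simp [h0], h1⟩
    | succ k ih =>
      obtain ⟨-, h2, h3⟩ := key k ih.1 ih.2
      refine ⟨?_, h3⟩
      have h2' : (γ : ℂ) * g (2 * (k + 1) + 1) =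
        (2 * k + 2 + γ) * (g (2 * (k + 1) + 1) - g (2 * (k + 1))) := h2
      rw [h2']
      push_cast
      ring
  intro n hn
  obtain ⟨k, rfl⟩ : ∃ k, n = k + 1 := ⟨n - 1, by omega⟩
  exact (key k (inv k).1 (inv k).2).1

/-- equidistant property on the boundary. -/
theorem stmt1 (γ : ℝ) (hγ0 : 0 < γ) (hγ2 : γ < 2)
    (α : ℝ) (hα0 : 0 < α) (hαπ : α < Real.pi)
    (f : ℕ → ℕ → ℂ) (hq : CrossRatioEq f) (hc : ConstraintC γ f)
    (hinit : InitialData f α) :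
    (∀ n : ℕ, 1 ≤ n →
        f (2 * n) 0 - f (2 * n - 1) 0 = f (2 * n + 1) 0 - f (2 * n) 0) ∧
    (∀ m : ℕ, 1 ≤ m →
        f 0 (2 * m) - f 0 (2 * m - 1) = f 0 (2 * m + 1) - f 0 (2 * m)) := by 
  obtain ⟨i0, i1, i2⟩ := hinit
  constructor
  · refine boundary_aux γ hγ0 (fun n => f n 0) i0 ?_ ?_
    · simp [i1]
    · intro n
      have h := hc n 0
      simpa using h
  · refine boundary_aux γ hγ0 (fun n => f 0 n) i0 ?_ ?_
    · simp [i2]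
    · intro n
      have h := hc 0 n
      simpa using h
end
end

section
/- For every real γ with 0 < γ < 2, the discrete map Z^γ maps the boundary axes of ℤ≥0² into the boundary rays of the sector of angle γπ/2: Z^γ(n,0) is a nonnegative real number (positive for n ≥ 1) for all n ≥ 0, and Z^γ(0,m) ∈ e^{iγπ/2}·ℝ≥0 (with positive modulus for m ≥ 1) for all m ≥ 0. -/
open Complex Real

noncomputable section

theorem axis_step (γ : ℝ) (hγ0 : 0 < γ) (hγ2 : γ < 2) (g : ℕ → ℂ) (c : ℂ) (hc0 : c ≠ 0)
    (h0 : g 0 = 0) (h1 : g 1 = c)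
    (h : ∀ n : ℕ, (γ : ℂ) * g (n + 1) =
      2 * ((n + 1 : ℕ) : ℂ) * ((g (n + 2) - g (n + 1)) * (g (n + 1) - g n)) /
        (g (n + 2) - g n)) (n : ℕ) :
    ∃ r s : ℝ, g n = c * r ∧ g (n + 1) = c * s ∧ 0 ≤ r ∧ r < s ∧
      γ * s < 2 * (n + 1) * (s - r) := by
  induction n with
  | zero => exact ⟨0, 1, by simp [h0], by simp [h1], le_refl _, one_pos, by norm_num; exact hγ2⟩
  | succ n ih =>
    obtain ⟨r, s, hr, hs, r0, rs, hlt⟩ := ih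
    have hn := h n
    have s0 : 0 < s := lt_of_le_of_lt r0 rs
    have hD : g (n + 2) - g n ≠ 0 := by
      intro hz
      rw [hz, div_zero, hs] at hn
      have hγ : (γ : ℂ) ≠ 0 := by exact_mod_cast hγ0.ne'
      have hsc : (s : ℂ) ≠ 0 := by exact_mod_cast s0.ne'
      exact mul_ne_zero hγ (mul_ne_zero hc0 hsc) hn
    rw [eq_div_iff hD, hs, hr] at hn
    have hd : 0 < 2 * ((n : ℝ) + 1) * (s - r) - γ * s := by linarith
    have hdc : ((2 * ((n : ℝ) + 1) * (s - r) - γ * s : ℝ) : ℂ) ≠ 0 := by exact_mod_cast hd.ne'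
    have hx : 0 < γ * s * (s - r) / (2 * ((n : ℝ) + 1) * (s - r) - γ * s) :=
      div_pos (mul_pos (mul_pos hγ0 s0) (by linarith)) hd
    set x := γ * s * (s - r) / (2 * ((n : ℝ) + 1) * (s - r) - γ * s) with hxdef
    have hxe : x * (2 * ((n : ℝ) + 1) * (s - r) - γ * s) = γ * s * (s - r) :=
      div_mul_cancel₀ _ hd.ne'
    have hxc : (x : ℂ) * (2 * ((n : ℂ) + 1) * (s - r) - γ * s) = γ * s * (s - r) := by
      exact_mod_cast hxe
    refine ⟨s, s + x, hs, ?_, s0.le, by linarith, ?_⟩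
    · push_cast at hn hdc ⊢
      apply mul_right_cancel₀ hdc
      apply mul_left_cancel₀ hc0
      show c * (g (n + 2) * _) = _
      linear_combination (-1 : ℂ) * hn - c * c * hxc
    · push_cast
      have h3 : 0 < ((2 * ((n : ℝ) + 1 + 1) - γ) * x - γ * s) *
          (2 * ((n : ℝ) + 1) * (s - r) - γ * s) := by
        have e : ((2 * ((n : ℝ) + 1 + 1) - γ) * x - γ * s) *
          (2 * ((n : ℝ) + 1) * (s - r) - γ * s) =
          γ * s * ((2 - γ) * (s - r) + γ * s) := by
          linear_combination (2 * ((n : ℝ) + 1 + 1) - γ) * hxe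
        rw [e]
        have := mul_pos (sub_pos.2 hγ2) (sub_pos.2 rs)
        positivity
      have := pos_of_mul_pos_left h3 hd.le
      linarith

/-- `Z^γ` maps the boundary axes into the boundary rays of the
sector of angle `γπ/2`. -/
theorem stmt10 (γ : ℝ) (hγ0 : 0 < γ) (hγ2 : γ < 2)
    (f : ℕ → ℕ → ℂ) (hq : CrossRatioEq f) (hc : ConstraintC γ f)
    (hinit : InitialData f (γ * Real.pi / 2)) :
    (∀ n : ℕ, (f n 0).im = 0 ∧ 0 ≤ (f n 0).re ∧ (1 ≤ n → 0 < (f n 0).re)) ∧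
    (∀ m : ℕ, ∃ r : ℝ, 0 ≤ r ∧ (1 ≤ m → 0 < r) ∧
      f 0 m = Complex.exp ((↑(γ * Real.pi / 2) : ℂ) * Complex.I) * (r : ℂ)) := by
  obtain ⟨h00, h10, h01⟩ := hinit
  have A := axis_step γ hγ0 hγ2 (fun n => f n 0) 1 one_ne_zero h00 h10
    (fun n => by simpa using hc (n + 1) 0)
  have B := axis_step γ hγ0 hγ2 (fun m => f 0 m) _ (Complex.exp_ne_zero _) h00 h01
    (fun m => by simpa using hc 0 (m + 1))
  constructor
  · intro n
    cases n with
    | zero => simp [h00]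
    | succ n =>
      obtain ⟨r, s, -, hs, r0, rs, -⟩ := A n
      have hs' : f (n + 1) 0 = (s : ℂ) := by simpa using hs
      rw [hs']
      simp only [Complex.ofReal_im, Complex.ofReal_re]
      exact ⟨trivial, by linarith, fun _ => by linarith⟩
  · intro m
    cases m with
    | zero => exact ⟨0, le_refl _, by simp, by simp [h00]⟩
    | succ m =>
      obtain ⟨r, s, -, hs, r0, rs, -⟩ := B m
      exact ⟨s, by linarith, fun _ => by linarith, hs⟩
end
end
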